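/- arXiv:1805.02115 — 4 statements merged into one kernel-verified Lean document; each statement's English description precedes it below -/
import Mathlib

section
/- Let 1 ≤ p < ∞, let n ≥ 1, and let X be a real Banach space. Then every continuous n-linear operator T : X × ⋯ × X → X (n factors) is Lipschitz p-summing if and only if X is finite-dimensional. -/
open scoped BigOperators

/-- `T` is Lipschitz `p`-summing with constant `c`. -/
def LipschitzPSumming {n : ℕ} {X : Fin n → Type*} [∀ i, NormedAddCommGroup (X i)]
    [∀ i, NormedSpace ℝ (X i)] {Y : Type*} [NormedAddCommGroup Y] [NormedSpace ℝ Y]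
    (p c : ℝ) (T : ContinuousMultilinearMap ℝ X Y) : Prop :=
  ∀ (k : ℕ) (u v : Fin k → ((i : Fin n) → X i)),
    (∑ i, ‖T (u i) - T (v i)‖ ^ p) ^ (1 / p) ≤
      c * ⨆ φ : {φ : ContinuousMultilinearMap ℝ X ℝ // ‖φ‖ ≤ 1},
        (∑ i, |φ.1 (u i) - φ.1 (v i)| ^ p) ^ (1 / p)

namespace LPS

/-- Linear forms bounded by the norm. -/
abbrev Dual1 (X : Type*) [NormedAddCommGroup X] [NormedSpace ℝ X] :=
  {l : X →ₗ[ℝ] ℝ // ∀ x, |l x| ≤ ‖x‖}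

/-- Bounded functions on a type. -/
def Bdd (D : Type*) : Submodule ℝ (D → ℝ) where
  carrier := {h | ∃ C : ℝ, ∀ d, |h d| ≤ C}
  zero_mem' := ⟨0, fun d => by simp⟩
  add_mem' := by
    rintro a b ⟨C, hC⟩ ⟨C', hC'⟩
    exact ⟨C + C', fun d => (abs_add_le _ _).trans (add_le_add (hC d) (hC' d))⟩
  smul_mem' := by
    rintro c a ⟨C, hC⟩
    refine ⟨|c| * C, fun d => ?_⟩
    simp only [Pi.smul_apply, smul_eq_mul, abs_mul]
    exact mul_le_mul_of_nonneg_left (hC d) (abs_nonneg _)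

variable {X : Type*} [NormedAddCommGroup X] [NormedSpace ℝ X]

/-- The function `d ↦ d x * d y`. -/
def q (x y : X) : Bdd (Dual1 X) :=
  ⟨fun d => d.1 x * d.1 y, ‖x‖ * ‖y‖, fun d => by
    rw [abs_mul]; exact mul_le_mul (d.2 x) (d.2 y) (abs_nonneg _) (norm_nonneg _)⟩

/-- The constant function one. -/
def one : Bdd (Dual1 X) := ⟨fun _ => 1, 1, fun _ => by simp⟩

/-- Pietsch domination, in functional form. -/
lemma pietsch (M : ℝ)
    (hM : ∀ (l : List X) (S : ℝ), (∀ d : Dual1 X, (l.map fun y => d.1 y ^ 2).sum ≤ S) →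
      (l.map fun y => ‖y‖ ^ 2).sum ≤ M * S) (hM0 : 0 < M) :
    ∃ g : Bdd (Dual1 X) →ₗ[ℝ] ℝ, g one = 1 ∧ (∀ h : Bdd (Dual1 X), (∀ d, 0 ≤ h.1 d) → 0 ≤ g h) ∧
      ∀ x, ‖x‖ ^ 2 ≤ M * g (q x x) := by
  let s : PointedCone ℝ (Bdd (Dual1 X)) :=
    { carrier := {h | ∃ l : List X, ∀ d : Dual1 X,
        M * (l.map fun y => d.1 y ^ 2).sum - (l.map fun y => ‖y‖ ^ 2).sum ≤ h.1 d}
      zero_mem' := ⟨[], fun d => by simp⟩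
      add_mem' := by
        rintro a b ⟨l, hl⟩ ⟨l', hl'⟩
        refine ⟨l ++ l', fun d => ?_⟩
        have h1 := hl d
        have h2 := hl' d
        simp only [List.map_append, List.sum_append, Submodule.coe_add, Pi.add_apply]
        linarith
      smul_mem' := by
        rintro ⟨c, hc⟩ a ⟨l, hl⟩
        refine ⟨l.map fun y => Real.sqrt c • y, fun d => ?_⟩
        have h1 := mul_le_mul_of_nonneg_left (hl d) hc
        have e1 : ((l.map fun y => Real.sqrt c • y).map fun y => d.1 y ^ 2).sum
            = c * (l.map fun y => d.1 y ^ 2).sum := by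
          rw [List.map_map, ← List.sum_map_mul_left]
          congr 1; apply List.map_congr_left; intro y _
          simp [mul_pow, Real.sq_sqrt hc]
        have e2 : ((l.map fun y => Real.sqrt c • y).map fun y => ‖y‖ ^ 2).sum
            = c * (l.map fun y => ‖y‖ ^ 2).sum := by
          rw [List.map_map, ← List.sum_map_mul_left]
          congr 1; apply List.map_congr_left; intro y _
          simp [norm_smul, mul_pow, Real.sq_sqrt hc]
        rw [e1, e2]
        change _ ≤ c * a.1 d
        linarith }
  have hone : (one : Bdd (Dual1 X)) ≠ 0 := by
    intro h
    have := congrFun (congrArg Subtype.val h) ⟨0, fun x => by simp⟩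
    simp [one] at this
  obtain ⟨g, hg1, hg2⟩ := riesz_extension s (LinearPMap.mkSpanSingleton (one : Bdd (Dual1 X)) (1:ℝ) hone)
    (by
      rintro ⟨x, hx⟩ hxs
      obtain ⟨c, rfl⟩ := Submodule.mem_span_singleton.1 hx
      obtain ⟨l, hl⟩ := hxs
      have hl' : ∀ d : Dual1 X,
        M * (l.map fun y => d.1 y ^ 2).sum - (l.map fun y => ‖y‖ ^ 2).sum ≤ c := by
        intro d
        have := hl d
        simpa [one] using this
      have hval : (LinearPMap.mkSpanSingleton (σ := RingHom.id ℝ) (one : Bdd (Dual1 X)) (1:ℝ) hone)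
          ⟨c • one, hx⟩ = c := by
        have := LinearPMap.mkSpanSingleton'_apply (σ := RingHom.id ℝ) (one : Bdd (Dual1 X)) (1:ℝ)
          (fun c hc => by
            rcases smul_eq_zero.1 hc with h | h
            · simp [h]
            · exact absurd h hone) c hx
        simpa using this
      rw [hval]
      have h1 := hM l ((c + (l.map fun y => ‖y‖ ^ 2).sum) / M) (fun d => by
        rw [le_div_iff₀ hM0]
        linarith [hl' d])
      rw [mul_div_cancel₀ _ hM0.ne'] at h1
      linarith)
    (by
      rintro ⟨h, C, hC⟩
      refine ⟨⟨C • one, Submodule.smul_mem _ _ (Submodule.mem_span_singleton_self _)⟩, [], fun d => ?_⟩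
      have := (abs_le.1 (hC d)).1
      simp [one]
      linarith)
  have h1 : g one = 1 := by
    have := hg1 ⟨one, Submodule.mem_span_singleton_self _⟩
    rw [this]
    exact LinearPMap.mkSpanSingleton_apply ℝ _ _ _
  refine ⟨g, h1, fun h hh => hg2 h ⟨[], fun d => by simpa using hh d⟩, fun x => ?_⟩
  have := hg2 (M • q x x - ‖x‖ ^ 2 • one) ⟨[x], fun d => by simp [q, one, pow_two]⟩
  simp only [map_sub, map_smul, h1, smul_eq_mul, mul_one] at this
  linarith

lemma findim_of_two (M : ℝ)
    (hM : ∀ (l : List X) (S : ℝ), (∀ d : Dual1 X, (l.map fun y => d.1 y ^ 2).sum ≤ S) →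
      (l.map fun y => ‖y‖ ^ 2).sum ≤ M * S) (hM0 : 0 < M) : FiniteDimensional ℝ X := by
  obtain ⟨g, g1, gpos, gM⟩ := pietsch M hM hM0
  let B0 : LinearMap.BilinForm ℝ X := LinearMap.mk₂ ℝ (fun x y => g (q x y))
    (fun x x' y => by rw [← map_add]; congr 1; ext d; simp [q, add_mul])
    (fun c x y => by rw [← map_smul]; congr 1; ext d; simp [q, mul_assoc])
    (fun x x' y => by rw [← map_add]; congr 1; ext d; simp [q, mul_add])
    (fun c x y => by rw [← map_smul]; congr 1; ext d; simp [q, mul_left_comm])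
  have hB0 : ∀ x y, B0 x y = g (q x y) := fun x y => rfl
  by_contra hfd
  obtain ⟨N, hN⟩ := exists_nat_gt M
  have hr : (N : Cardinal) ≤ Module.rank ℝ X := by
    have : Cardinal.aleph0 ≤ Module.rank ℝ X := by
      rw [← not_lt, Module.rank_lt_aleph0_iff]; exact hfd
    exact (Cardinal.natCast_lt_aleph0).le.trans this
  obtain ⟨f, hf⟩ := exists_linearIndependent_of_le_rank hr
  let E := Submodule.span ℝ (Set.range f)
  have hE : Module.finrank ℝ E = N := by
    rw [finrank_span_eq_card hf]; simp
  have : FiniteDimensional ℝ E := FiniteDimensional.span_of_finite ℝ (Set.finite_range f)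
  let B : LinearMap.BilinForm ℝ E := B0.restrict E
  have hBsymm : LinearMap.IsSymm B := ⟨fun x y => by
    change g (q x.1 y.1) = g (q y.1 x.1)
    congr 1; ext d; simp [q, mul_comm]⟩
  have : Invertible (2:ℝ) := invertibleOfNonzero two_ne_zero
  obtain ⟨v, hv⟩ := LinearMap.BilinForm.exists_orthogonal_basis hBsymm
  have hort : ∀ i j, i ≠ j → B0 (v i).1 (v j).1 = 0 := fun i j hij => hv hij
  let b := fun i => B0 (v i).1 (v i).1
  have hb : ∀ i, 0 < b i := by
    intro i
    have h1 := gM (v i).1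
    have h2 : (v i).1 ≠ 0 := fun h => v.ne_zero i (Subtype.ext h)
    have h3 : 0 < ‖(v i).1‖ ^ 2 := by positivity
    have h4 : 0 < M * b i := h3.trans_le h1
    exact (pos_iff_pos_of_mul_pos h4).1 ((pos_of_mul_pos_left h4 (gpos _ fun d => mul_self_nonneg _)))
  have key : ∀ d : Dual1 X, ∑ i, d.1 (v i).1 ^ 2 / b i ≤ M := by
    intro d
    set s := ∑ i, d.1 (v i).1 ^ 2 / b i with hs
    have hs0 : 0 ≤ s := Finset.sum_nonneg fun i _ => div_nonneg (sq_nonneg _) (hb i).le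
    let x : X := ∑ i, (d.1 (v i).1 / b i) • (v i).1
    have hdx : d.1 x = s := by
      simp only [x, map_sum, map_smul, smul_eq_mul, hs]
      refine Finset.sum_congr rfl fun i _ => by ring
    have hBx : B0 x x = s := by
      simp only [x, map_sum, map_smul, LinearMap.sum_apply, LinearMap.smul_apply, smul_eq_mul, hs]
      refine Finset.sum_congr rfl fun i _ => ?_
      rw [Finset.sum_eq_single i]
      · change _ * (_ * b i) = _
        have := (hb i).ne'
        field_simp
      · intro j _ hji
        simp [hort _ _ hji, hort _ _ hji.symm]
      · simp
    have h1 := gM x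
    rw [← hB0, hBx] at h1
    have h2 : s ^ 2 ≤ ‖x‖ ^ 2 := by
      have := d.2 x
      rw [hdx] at this
      exact sq_le_sq.2 (by rwa [abs_norm])
    by_contra hlt
    push Not at hlt
    nlinarith
  have h5 := gpos (M • one - ∑ i, (1 / b i) • q (v i).1 (v i).1) (by
    intro d
    have := key d
    have e : (M • (one : Bdd (Dual1 X)) - ∑ i, (1 / b i) • q (v i).1 (v i).1).1 d
        = M - ∑ i, d.1 (v i).1 ^ 2 / b i := by
      simp only [Submodule.coe_sub, Submodule.coe_sum, Submodule.coe_smul, Pi.sub_apply,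
        Finset.sum_apply, Pi.smul_apply, smul_eq_mul, one, q]
      rw [mul_one]
      congr 1
      exact Finset.sum_congr rfl fun i _ => by ring
    rw [e]; linarith)
  have h6 : ∑ i, (1 / b i) * g (q (v i).1 (v i).1) = (N : ℝ) := by
    rw [← hE, Finset.sum_congr rfl (g := fun _ => (1:ℝ))]
    · simp
    · intro i _
      exact one_div_mul_cancel (hb i).ne'
  simp only [map_sub, map_smul, map_sum, g1, smul_eq_mul, mul_one] at h5
  rw [h6] at h5
  linarith

lemma term_bound {p : ℝ} (hp : 1 ≤ p) {K : ℝ} (hK : 0 < K) (d : Dual1 X) (y : X) :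
    |d.1 (‖y‖ ^ (2 / p - 1) • y)| ^ p ≤ ‖y‖ ^ 2 / (2 * K) + K / 2 * d.1 y ^ 2 := by
  have hp0 : 0 < p := by linarith
  rcases eq_or_ne y 0 with rfl | hy
  · simp [Real.zero_rpow hp0.ne']
  have hy0 : 0 < ‖y‖ := norm_pos_iff.2 hy
  have h1 : |d.1 (‖y‖ ^ (2 / p - 1) • y)| ^ p ≤ ‖y‖ * |d.1 y| := by
    rw [map_smul, smul_eq_mul, abs_mul, abs_of_pos (Real.rpow_pos_of_pos hy0 _),
      Real.mul_rpow (Real.rpow_nonneg hy0.le _) (abs_nonneg _), ← Real.rpow_mul hy0.le]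
    have e : (2 / p - 1) * p = (2 - p) := by field_simp
    rw [e]
    have h2 : |d.1 y| ^ p ≤ ‖y‖ ^ (p - 1) * |d.1 y| := by
      rcases (abs_nonneg (d.1 y)).eq_or_lt with h | h
      · rw [← h]; simp [Real.zero_rpow hp0.ne']
      · have : |d.1 y| ^ p = |d.1 y| ^ (p - 1) * |d.1 y| := by
          rw [Real.rpow_sub_one h.ne']; field_simp
        rw [this]
        exact mul_le_mul_of_nonneg_right
          (Real.rpow_le_rpow (abs_nonneg _) (d.2 y) (by linarith)) (abs_nonneg _)
    calc ‖y‖ ^ (2 - p) * |d.1 y| ^ p ≤ ‖y‖ ^ (2 - p) * (‖y‖ ^ (p - 1) * |d.1 y|) := by gcongr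
      _ = ‖y‖ * |d.1 y| := by
        rw [← mul_assoc, ← Real.rpow_add hy0]
        norm_num
  refine h1.trans ?_
  have h3 : ‖y‖ ^ 2 / (2 * K) + K / 2 * d.1 y ^ 2 - ‖y‖ * |d.1 y|
      = (‖y‖ - K * |d.1 y|) ^ 2 / (2 * K) := by
    rw [← sq_abs (d.1 y)]
    field_simp
    ring
  have : 0 ≤ (‖y‖ - K * |d.1 y|) ^ 2 / (2 * K) := by positivity
  linarith

lemma findim_of_p {p : ℝ} (hp : 1 ≤ p) (K : ℝ) (hK : 0 < K)
    (h : ∀ (k : ℕ) (x : Fin k → X) (S : ℝ), (∀ d : Dual1 X, ∑ i, |d.1 (x i)| ^ p ≤ S) →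
      ∑ i, ‖x i‖ ^ p ≤ K * S) : FiniteDimensional ℝ X := by
  have hp0 : 0 < p := by linarith
  refine findim_of_two (K ^ 2) (fun l S hS => ?_) (pow_pos hK 2)
  have conv : ∀ f : X → ℝ, (l.map f).sum = ∑ i : Fin l.length, f (l.get i) := by
    intro f
    simp
  simp only [conv] at hS ⊢
  set A := ∑ i : Fin l.length, ‖l.get i‖ ^ 2 with hA
  have h1 := h l.length (fun i => ‖l.get i‖ ^ (2 / p - 1) • l.get i) (A / (2 * K) + K / 2 * S) (by
    intro d
    refine (Finset.sum_le_sum fun i _ => term_bound hp hK d (l.get i)).trans ?_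
    rw [Finset.sum_add_distrib, ← Finset.sum_div, ← Finset.mul_sum]
    have := hS d
    gcongr)
  have h2 : ∑ i : Fin l.length, ‖‖l.get i‖ ^ (2 / p - 1) • l.get i‖ ^ p = A := by
    refine Finset.sum_congr rfl fun i _ => ?_
    rcases eq_or_ne (l.get i) 0 with hy | hy
    · rw [hy]; simp [Real.zero_rpow hp0.ne']
    have hy0 : 0 < ‖l.get i‖ := norm_pos_iff.2 hy
    rw [norm_smul, Real.norm_of_nonneg (Real.rpow_nonneg hy0.le _),
      ← Real.rpow_add_one hy0.ne', ← Real.rpow_mul hy0.le]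
    have e : (2 / p - 1 + 1) * p = (2 : ℕ) := by field_simp; norm_num
    rw [e, Real.rpow_natCast]
  rw [h2] at h1
  have h3 : K * (A / (2 * K) + K / 2 * S) = A / 2 + K ^ 2 * S / 2 := by field_simp
  linarith

lemma findim_of_all (p : ℝ) (hp : 1 ≤ p) (m : ℕ)
    (h : ∀ T : ContinuousMultilinearMap ℝ (fun _ : Fin (m + 1) => X) X,
        ∃ c : ℝ, 0 ≤ c ∧ LipschitzPSumming p c T) : FiniteDimensional ℝ X := by
  have hp0 : 0 < p := by linarith
  rcases subsingleton_or_nontrivial X with hX | hX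
  · infer_instance
  obtain ⟨a, ha⟩ := exists_norm_eq X zero_le_one
  obtain ⟨ψ, -, hψ⟩ := exists_dual_vector ℝ a (by rw [ha]; norm_num)
  have hψa : ψ a = 1 := by rw [hψ, ha]; simp
  let P : ContinuousMultilinearMap ℝ (fun _ : Fin m => X) ℝ :=
    (ContinuousMultilinearMap.mkPiAlgebra ℝ (Fin m) ℝ).compContinuousLinearMap (fun _ => ψ)
  let T : ContinuousMultilinearMap ℝ (fun _ : Fin (m + 1) => X) X :=
    ContinuousLinearMap.uncurryLeft (Ei := fun _ : Fin (m + 1) => X)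
      (ContinuousMultilinearMap.smulRightL ℝ (fun _ : Fin m => X) X P)
  have hT : ∀ x : X, T (Fin.cons x (fun _ => a)) = x := by
    intro x
    simp [T, P, ContinuousLinearMap.uncurryLeft_apply, hψa, Fin.tail]
  obtain ⟨c, hc, hT'⟩ := h T
  refine findim_of_p hp ((c + 1) ^ p) (by positivity) fun k x S hS => ?_
  have hS0 : 0 ≤ S := by
    have := hS ⟨0, fun x => by simp⟩
    simpa [Real.zero_rpow hp0.ne'] using this
  have h1 := hT' k (fun i => Fin.cons (x i) (fun _ => a)) (fun _ => 0)
  have hT0 : T 0 = 0 := T.map_zero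
  simp only [hT, hT0, sub_zero] at h1
  have h2 : (⨆ φ : {φ : ContinuousMultilinearMap ℝ (fun _ : Fin (m + 1) => X) ℝ // ‖φ‖ ≤ 1},
        (∑ i, |φ.1 (Fin.cons (x i) (fun _ => a)) - φ.1 0| ^ p) ^ (1 / p)) ≤ S ^ (1 / p) := by
    have : Nonempty {φ : ContinuousMultilinearMap ℝ (fun _ : Fin (m + 1) => X) ℝ // ‖φ‖ ≤ 1} :=
      ⟨⟨0, by simp⟩⟩
    refine ciSup_le fun φ => ?_
    refine Real.rpow_le_rpow (Finset.sum_nonneg fun i _ => by positivity) ?_ (by positivity)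
    have hφ0 : φ.1 0 = 0 := φ.1.map_zero
    let d : Dual1 X := ⟨
      { toFun := fun x => φ.1.curryLeft x (fun _ => a)
        map_add' := fun x y => by simp only [map_add]; rfl
        map_smul' := fun r x => by simp only [map_smul]; rfl }, fun x => by
        change |φ.1 (Fin.cons x (fun _ => a))| ≤ ‖x‖
        have h3 := φ.1.le_of_opNorm_le φ.2 (Fin.cons x (fun _ => a))
        rw [Fin.prod_univ_succ] at h3
        simpa [ha] using h3⟩
    have h4 := hS d
    simp only [hφ0, sub_zero]
    exact h4
  have h3 : (∑ i, ‖x i‖ ^ p) ^ (1 / p) ≤ (c + 1) * S ^ (1 / p) := by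
    refine h1.trans ((mul_le_mul_of_nonneg_left h2 hc).trans ?_)
    have := Real.rpow_nonneg hS0 (1 / p)
    nlinarith
  have hs : 0 ≤ ∑ i, ‖x i‖ ^ p := Finset.sum_nonneg fun i _ => by positivity
  have h4 := Real.rpow_le_rpow (by positivity) h3 hp0.le
  rwa [Real.mul_rpow (by positivity) (by positivity), ← Real.rpow_mul hs, ← Real.rpow_mul hS0,
    one_div_mul_cancel hp0.ne', Real.rpow_one, Real.rpow_one] at h4

lemma all_of_findim [FiniteDimensional ℝ X] (p : ℝ) (hp : 1 ≤ p) (n : ℕ)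
    (T : ContinuousMultilinearMap ℝ (fun _ : Fin n => X) X) :
    ∃ c : ℝ, 0 ≤ c ∧ LipschitzPSumming p c T := by
  have hp0 : 0 < p := by linarith
  let N := Module.finrank ℝ X
  let e : X ≃L[ℝ] (Fin N → ℝ) := (Module.finBasis ℝ X).equivFunL
  let C : ℝ := ‖(e.symm : (Fin N → ℝ) →L[ℝ] X)‖
  let F : Fin N → ContinuousMultilinearMap ℝ (fun _ : Fin n => X) ℝ := fun j =>
    ((ContinuousLinearMap.proj j : (Fin N → ℝ) →L[ℝ] ℝ).comp
      (e : X →L[ℝ] (Fin N → ℝ))).compContinuousMultilinearMap T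
  have hF : ∀ j u, F j u = e (T u) j := fun j u => rfl
  let R : ℝ := 1 + ∑ j, ‖F j‖
  have hR : ∀ j, ‖F j‖ ≤ R := fun j => by
    have := Finset.single_le_sum (f := fun j => ‖F j‖) (fun j _ => norm_nonneg _) (Finset.mem_univ j)
    simp only [R]; linarith
  have hR0 : 0 < R := by
    have : 0 ≤ ∑ j, ‖F j‖ := Finset.sum_nonneg fun j _ => norm_nonneg _
    simp only [R]; linarith
  have hC0 : 0 ≤ C := norm_nonneg _
  have hnorm : ∀ y : X, ‖y‖ ^ p ≤ C ^ p * ∑ j, |e y j| ^ p := by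
    intro y
    have h1 : ‖y‖ ≤ C * ‖e y‖ := by
      have := (e.symm : (Fin N → ℝ) →L[ℝ] X).le_opNorm (e y)
      simpa using this
    have h2 : ‖e y‖ ≤ (∑ j, |e y j| ^ p) ^ (1 / p) := by
      refine (pi_norm_le_iff_of_nonneg (by positivity)).2 fun j => ?_
      have h3 := Finset.single_le_sum (f := fun j => |e y j| ^ p) (fun j _ => by positivity)
        (Finset.mem_univ j)
      have h4 := Real.rpow_le_rpow (by positivity) h3 (by positivity : 0 ≤ 1 / p)
      rwa [← Real.rpow_mul (abs_nonneg _), mul_one_div_cancel hp0.ne', Real.rpow_one] at h4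
    have h5 := Real.rpow_le_rpow (norm_nonneg _) (h1.trans (mul_le_mul_of_nonneg_left h2 hC0)) hp0.le
    rwa [Real.mul_rpow hC0 (by positivity), ← Real.rpow_mul (by positivity),
      one_div_mul_cancel hp0.ne', Real.rpow_one] at h5
  refine ⟨C * (N : ℝ) ^ (1 / p) * R, by positivity, fun k u v => ?_⟩
  set S := ⨆ φ : {φ : ContinuousMultilinearMap ℝ (fun _ : Fin n => X) ℝ // ‖φ‖ ≤ 1},
        (∑ i, |φ.1 (u i) - φ.1 (v i)| ^ p) ^ (1 / p) with hSdef
  have hbdd : BddAbove (Set.range fun φ : {φ : ContinuousMultilinearMap ℝ (fun _ : Fin n => X) ℝ //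
      ‖φ‖ ≤ 1} => (∑ i, |φ.1 (u i) - φ.1 (v i)| ^ p) ^ (1 / p)) := by
    refine ⟨(∑ i, ((∏ j, ‖u i j‖) + ∏ j, ‖v i j‖) ^ p) ^ (1 / p), ?_⟩
    rintro _ ⟨φ, rfl⟩
    refine Real.rpow_le_rpow (by positivity) (Finset.sum_le_sum fun i _ =>
      Real.rpow_le_rpow (abs_nonneg _) ?_ hp0.le) (by positivity)
    have h1 := φ.1.le_of_opNorm_le φ.2 (u i)
    have h2 := φ.1.le_of_opNorm_le φ.2 (v i)
    rw [one_mul, Real.norm_eq_abs] at h1 h2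
    exact (abs_sub _ _).trans (add_le_add h1 h2)
  have hS0 : 0 ≤ S := Real.iSup_nonneg fun φ => by positivity
  have hj : ∀ j, ∑ i, |F j (u i) - F j (v i)| ^ p ≤ (R * S) ^ p := by
    intro j
    have h1 := le_ciSup hbdd ⟨R⁻¹ • F j, by
      rw [norm_smul, norm_inv, Real.norm_of_nonneg hR0.le, inv_mul_le_iff₀ hR0, mul_one]
      exact hR j⟩
    rw [← hSdef] at h1
    have h2 := Real.rpow_le_rpow (by positivity) h1 hp0.le
    rw [← Real.rpow_mul (by positivity), one_div_mul_cancel hp0.ne', Real.rpow_one] at h2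
    rw [Real.mul_rpow hR0.le hS0]
    refine le_trans (le_of_eq ?_) (mul_le_mul_of_nonneg_left h2 (by positivity))
    rw [Finset.mul_sum]
    refine Finset.sum_congr rfl fun i _ => ?_
    rw [← Real.mul_rpow hR0.le (abs_nonneg _)]
    congr 1
    rw [ContinuousMultilinearMap.smul_apply, ContinuousMultilinearMap.smul_apply, ← smul_sub,
      smul_eq_mul, abs_mul, abs_of_pos (inv_pos.2 hR0), mul_inv_cancel_left₀ hR0.ne']
  have hfin : ∑ i, ‖T (u i) - T (v i)‖ ^ p ≤ C ^ p * (N * (R * S) ^ p) := by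
    calc ∑ i, ‖T (u i) - T (v i)‖ ^ p
        ≤ ∑ i, C ^ p * ∑ j, |F j (u i) - F j (v i)| ^ p := Finset.sum_le_sum fun i _ => by
          have := hnorm (T (u i) - T (v i))
          simpa only [map_sub, Pi.sub_apply, hF] using this
      _ = C ^ p * ∑ j, ∑ i, |F j (u i) - F j (v i)| ^ p := by
          rw [← Finset.mul_sum, Finset.sum_comm]
      _ ≤ C ^ p * ∑ j : Fin N, (R * S) ^ p := by
          gcongr with j; exact hj j
      _ = _ := by simp
  have h7 := Real.rpow_le_rpow (by positivity) hfin (by positivity : 0 ≤ 1 / p)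
  refine h7.trans (le_of_eq ?_)
  rw [Real.mul_rpow (by positivity) (by positivity), Real.mul_rpow (by positivity) (by positivity),
    ← Real.rpow_mul hC0, ← Real.rpow_mul (by positivity), mul_one_div_cancel hp0.ne',
    Real.rpow_one, Real.rpow_one]
  ring

end LPS

/-- Weak Dvoretzky–Rogers theorem: every continuous `n`-linear operator
`T : X × ⋯ × X → X` is Lipschitz `p`-summing if and only if `X` is
finite-dimensional. -/
theorem lipschitzPSumming_all_iff_finiteDimensional
    {X : Type*} [NormedAddCommGroup X] [NormedSpace ℝ X] [CompleteSpace X]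
    (p : ℝ) (hp : 1 ≤ p) (n : ℕ) (hn : 1 ≤ n) :
    (∀ T : ContinuousMultilinearMap ℝ (fun _ : Fin n => X) X,
        ∃ c : ℝ, 0 ≤ c ∧ LipschitzPSumming p c T) ↔
      FiniteDimensional ℝ X := by
  constructor
  · intro h
    obtain ⟨m, rfl⟩ : ∃ m, n = m + 1 := ⟨n - 1, by omega⟩
    exact LPS.findim_of_all p hp m h
  · intro _ T
    exact LPS.all_of_findim p hp n T
end

section
/- Let n ≥ 1, let X₁, …, Xₙ be real Banach spaces each of which is an 𝓛₁-space, and let Y be a real Banach space which is an 𝓛₂-space. Then every continuous n-linear operator T : X₁ × ⋯ × Xₙ → Y is Lipschitz 1-summing. -/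
open scoped BigOperators ENNReal

/-- `X` is an `𝓛_p`-space: for some `λ ≥ 1`, every finite-dimensional subspace is
contained in a finite-dimensional subspace `F` which is `λ`-isomorphic to
`ℓ_p^{dim F}`. -/
def IsLpSpace (p : ℝ≥0∞) [Fact (1 ≤ p)] (X : Type*) [NormedAddCommGroup X]
    [NormedSpace ℝ X] : Prop :=
  ∃ lam : ℝ, 1 ≤ lam ∧ ∀ E : Submodule ℝ X, FiniteDimensional ℝ E →
    ∃ F : Submodule ℝ X, E ≤ F ∧ FiniteDimensional ℝ F ∧
      ∃ S : F ≃L[ℝ] PiLp p (fun _ : Fin (Module.finrank ℝ F) => ℝ),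
        ‖S.toContinuousLinearMap‖ * ‖S.symm.toContinuousLinearMap‖ ≤ lam

/-- Signed sum attached to a sign pattern. -/
noncomputable def radSum {d : ℕ} (x : Fin d → ℝ) (ω : Fin d → Bool) : ℝ :=
  ∑ k, x k * (if ω k then 1 else -1)

theorem radSum_cons {d : ℕ} (x : Fin (d+1) → ℝ) (b : Bool) (ω : Fin d → Bool) :
    radSum x (Fin.cons b ω) = x 0 * (if b then 1 else -1) + radSum (fun k => x k.succ) ω := by
  simp [radSum, Fin.sum_univ_succ]

theorem sum_cube_succ {d : ℕ} (f : (Fin (d+1) → Bool) → ℝ) :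
    ∑ ω, f ω = ∑ ω : Fin d → Bool, (f (Fin.cons true ω) + f (Fin.cons false ω)) := by
  rw [← (Fin.consEquiv (fun _ : Fin (d+1) => Bool)).sum_comp, Fintype.sum_prod_type]
  simp [Fin.consEquiv, Finset.sum_add_distrib]

theorem radSum_mul {d : ℕ} (x y : Fin d → ℝ) :
    ∑ ω, radSum x ω * radSum y ω = 2 ^ d * ∑ k, x k * y k := by
  induction d with
  | zero => simp [radSum]
  | succ d ih =>
    rw [sum_cube_succ, Fin.sum_univ_succ, mul_add, pow_succ, mul_assoc, mul_assoc (2 ^ d) 2]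
    rw [mul_left_comm (2 ^ d) 2 (∑ k : Fin d, _), ← ih]
    have h : ∀ ω : Fin d → Bool, radSum x (Fin.cons true ω) * radSum y (Fin.cons true ω)
        + radSum x (Fin.cons false ω) * radSum y (Fin.cons false ω)
        = 2 * (x 0 * y 0) + 2 * (radSum (fun k => x k.succ) ω * radSum (fun k => y k.succ) ω) := by
      intro ω
      simp only [radSum_cons]
      simp
      ring
    simp only [h, Finset.sum_add_distrib, ← Finset.mul_sum]
    simp
    ring

theorem radSum_four {d : ℕ} (x : Fin d → ℝ) :
    ∑ ω, radSum x ω ^ 4 ≤ 3 * 2 ^ d * (∑ k, x k ^ 2) ^ 2 := by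
  induction d with
  | zero => simp [radSum]
  | succ d ih =>
    rw [sum_cube_succ, Fin.sum_univ_succ]
    have h : ∀ ω : Fin d → Bool, radSum x (Fin.cons true ω) ^ 4 + radSum x (Fin.cons false ω) ^ 4
        = 2 * (x 0) ^ 4 + 2 * radSum (fun k => x k.succ) ω ^ 4
          + 12 * (x 0) ^ 2 * (radSum (fun k => x k.succ) ω * radSum (fun k => x k.succ) ω) := by
      intro ω
      simp only [radSum_cons]
      simp
      ring
    simp only [h, Finset.sum_add_distrib, ← Finset.mul_sum, radSum_mul]
    have := ih (fun k => x k.succ)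
    have e : ∑ k : Fin d, x k.succ * x k.succ = ∑ k : Fin d, x k.succ ^ 2 := by
      simp only [sq]
    rw [e]
    simp only [Finset.sum_const, Finset.card_univ, Fintype.card_fun, Fintype.card_bool,
      Fintype.card_fin, nsmul_eq_mul, Nat.cast_pow, Nat.cast_ofNat]
    have h2 : (0:ℝ) ≤ 2 ^ d * x 0 ^ 4 := by positivity
    rw [pow_succ 2 d]
    nlinarith

def GP {I J : Type*} [Fintype I] [Fintype J] (a : I → J → ℝ) (K : ℝ) : Prop :=
  ∀ (d : ℕ) (x : I → Fin d → ℝ) (y : J → Fin d → ℝ), (∀ i, ∑ k, x i k ^ 2 ≤ 1) →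
    (∀ j, ∑ k, y j k ^ 2 ≤ 1) → ∑ i, ∑ j, a i j * ∑ k, x i k * y j k ≤ K

theorem GP.scale {I J : Type*} [Fintype I] [Fintype J] {a : I → J → ℝ} {K : ℝ} (h : GP a K)
    {D : Type*} [Fintype D] (x : I → D → ℝ) (y : J → D → ℝ) (w : ℝ) (hw : 0 < w)
    (hx : ∀ i, ∑ k, x i k ^ 2 ≤ w) (hy : ∀ j, ∑ k, y j k ^ 2 ≤ w) :
    ∑ i, ∑ j, a i j * ∑ k, x i k * y j k ≤ K * w := by
  have hs : √w * √w = w := Real.mul_self_sqrt hw.le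
  have hs2 : √w ^ 2 = w := Real.sq_sqrt hw.le
  let e := Fintype.equivFin D
  have key := h (Fintype.card D) (fun i k => x i (e.symm k) / √w) (fun j k => y j (e.symm k) / √w)
    (fun i => by
      rw [e.symm.sum_comp (fun k => (x i k / √w) ^ 2)]
      simp only [div_pow, ← Finset.sum_div, hs2]
      exact (div_le_one hw).2 (hx i))
    (fun i => by
      rw [e.symm.sum_comp (fun k => (y i k / √w) ^ 2)]
      simp only [div_pow, ← Finset.sum_div, hs2]
      exact (div_le_one hw).2 (hy i))
  have e1 : ∀ i j, ∑ k, x i (e.symm k) / √w * (y j (e.symm k) / √w) = (∑ k, x i k * y j k) / w := by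
    intro i j
    rw [e.symm.sum_comp (fun k => x i k / √w * (y j k / √w))]
    simp only [div_mul_div_comm, hs, Finset.sum_div]
  simp only [e1] at key
  simp only [← mul_div_assoc, ← Finset.sum_div] at key
  exact (div_le_iff₀ hw).1 key

noncomputable def clip (t : ℝ) : ℝ := max (-2) (min 2 t)

theorem clip_abs (t : ℝ) : |clip t| ≤ 2 := by
  unfold clip; rw [abs_le]; constructor
  · exact le_max_left _ _
  · exact max_le (by norm_num) (min_le_left _ _)

theorem clip_sq (t : ℝ) : clip t ^ 2 ≤ t ^ 2 := by
  unfold clip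
  rcases le_total 2 t with h | h
  · rw [min_eq_left h, max_eq_right (by norm_num)]; nlinarith
  · rw [min_eq_right h]
    rcases le_total (-2) t with h' | h'
    · rw [max_eq_right h']
    · rw [max_eq_left h']; nlinarith

theorem clip_err (t : ℝ) : (t - clip t) ^ 2 ≤ t ^ 4 / 64 := by
  unfold clip
  rcases le_total 2 t with h | h
  · rw [min_eq_left h, max_eq_right (by norm_num)]
    have h1 : t - 2 ≤ t ^ 2 / 8 := by nlinarith [sq_nonneg (t - 4)]
    calc (t - 2) ^ 2 ≤ (t ^ 2 / 8) ^ 2 := pow_le_pow_left₀ (by linarith) h1 2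
      _ = _ := by ring
  · rw [min_eq_right h]
    rcases le_total (-2) t with h' | h'
    · rw [max_eq_right h']; simp; positivity
    · rw [max_eq_left h']
      have h1 : -t - 2 ≤ t ^ 2 / 8 := by nlinarith [sq_nonneg (t + 4)]
      calc (t - -2) ^ 2 = (-t - 2) ^ 2 := by ring
        _ ≤ (t ^ 2 / 8) ^ 2 := pow_le_pow_left₀ (by linarith) h1 2
        _ = _ := by ring

theorem GP.step {I J : Type*} [Fintype I] [Fintype J] {a : I → J → ℝ} {N K : ℝ}
    (hN : ∀ (s : I → ℝ) (t : J → ℝ), (∀ i, |s i| ≤ 1) → (∀ j, |t j| ≤ 1) →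
      ∑ i, ∑ j, a i j * (s i * t j) ≤ N) (h : GP a K) : GP a (4 * N + K / 2) := by
  intro d x y hx hy
  have hw : (0:ℝ) < 2 ^ d := by positivity
  have m2 : ∀ z : Fin d → ℝ, ∑ k, z k ^ 2 ≤ 1 → ∑ ω, radSum z ω ^ 2 ≤ 2 ^ d := by
    intro z hz
    have := radSum_mul z z
    simp only [← sq] at this
    rw [this]; nlinarith
  have c2 : ∀ z : Fin d → ℝ, ∑ k, z k ^ 2 ≤ 1 → ∑ ω, clip (radSum z ω) ^ 2 ≤ 2 ^ d := fun z hz =>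
    (Finset.sum_le_sum fun ω _ => clip_sq _).trans (m2 z hz)
  have e2 : ∀ z : Fin d → ℝ, ∑ k, z k ^ 2 ≤ 1 →
      ∑ ω, (4 * (radSum z ω - clip (radSum z ω))) ^ 2 ≤ 2 ^ d := by
    intro z hz
    have h4 := radSum_four z
    have h5 : (∑ k, z k ^ 2) ^ 2 ≤ 1 := pow_le_one₀ (Finset.sum_nonneg fun k _ => sq_nonneg _) hz
    have : ∑ ω, (4 * (radSum z ω - clip (radSum z ω))) ^ 2 ≤ ∑ ω, radSum z ω ^ 4 / 4 :=
      Finset.sum_le_sum fun ω _ => by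
        have := clip_err (radSum z ω)
        rw [mul_pow]; linarith
    rw [← Finset.sum_div] at this
    nlinarith
  have t1 := h.scale (fun i ω => clip (radSum (x i) ω))
    (fun j ω => 4 * (radSum (y j) ω - clip (radSum (y j) ω))) (2 ^ d) hw
    (fun i => c2 _ (hx i)) (fun j => e2 _ (hy j))
  have t2 := h.scale (fun i ω => 4 * (radSum (x i) ω - clip (radSum (x i) ω)))
    (fun j ω => radSum (y j) ω) (2 ^ d) hw
    (fun i => e2 _ (hx i)) (fun j => m2 _ (hy j))
  have t3 : ∑ i, ∑ j, a i j * ∑ ω, clip (radSum (x i) ω) * clip (radSum (y j) ω) ≤ 4 * N * 2 ^ d := by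
    have : ∀ ω : Fin d → Bool, ∑ i, ∑ j, a i j * (clip (radSum (x i) ω) * clip (radSum (y j) ω))
        ≤ 4 * N := by
      intro ω
      have := hN (fun i => clip (radSum (x i) ω) / 2) (fun j => clip (radSum (y j) ω) / 2)
        (fun i => by rw [abs_div, abs_two, div_le_one two_pos]; exact clip_abs _)
        (fun i => by rw [abs_div, abs_two, div_le_one two_pos]; exact clip_abs _)
      have e : ∀ i j, a i j * (clip (radSum (x i) ω) / 2 * (clip (radSum (y j) ω) / 2))
        = a i j * (clip (radSum (x i) ω) * clip (radSum (y j) ω)) / 4 := fun i j => by ring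
      simp only [e, ← Finset.sum_div] at this
      linarith
    calc _ = ∑ ω : Fin d → Bool, ∑ i, ∑ j, a i j * (clip (radSum (x i) ω) * clip (radSum (y j) ω)) := by
          symm
          rw [Finset.sum_comm]
          refine Finset.sum_congr rfl fun i _ => ?_
          rw [Finset.sum_comm]
          exact Finset.sum_congr rfl fun j _ => (Finset.mul_sum _ _ _).symm
      _ ≤ ∑ ω : Fin d → Bool, 4 * N := Finset.sum_le_sum fun ω _ => this ω
      _ = _ := by simp [mul_comm]
  have e : 2 ^ d * ∑ i, ∑ j, a i j * ∑ k, x i k * y j k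
      = ∑ i, ∑ j, a i j * ∑ ω, clip (radSum (x i) ω) * clip (radSum (y j) ω)
      + (∑ i, ∑ j, a i j * ∑ ω, clip (radSum (x i) ω) * (4 * (radSum (y j) ω - clip (radSum (y j) ω)))) / 4
      + (∑ i, ∑ j, a i j * ∑ ω, (4 * (radSum (x i) ω - clip (radSum (x i) ω))) * radSum (y j) ω) / 4 := by
    rw [Finset.mul_sum, Finset.sum_div, Finset.sum_div, ← Finset.sum_add_distrib,
      ← Finset.sum_add_distrib]
    refine Finset.sum_congr rfl fun i _ => ?_
    rw [Finset.mul_sum, Finset.sum_div, Finset.sum_div, ← Finset.sum_add_distrib,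
      ← Finset.sum_add_distrib]
    refine Finset.sum_congr rfl fun j _ => ?_
    rw [mul_left_comm, ← radSum_mul, mul_div_assoc, mul_div_assoc, ← mul_add, ← mul_add]
    congr 1
    simp only [Finset.sum_div, ← Finset.sum_add_distrib]
    exact Finset.sum_congr rfl fun ω _ => by ring
  have : 2 ^ d * ∑ i, ∑ j, a i j * ∑ k, x i k * y j k ≤ 2 ^ d * (4 * N + K / 2) := by
    rw [e]; linarith
  exact le_of_mul_le_mul_left this hw

theorem grothendieck_ineq {I J : Type*} [Fintype I] [Fintype J] {a : I → J → ℝ} {N : ℝ}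
    (hN : ∀ (s : I → ℝ) (t : J → ℝ), (∀ i, |s i| ≤ 1) → (∀ j, |t j| ≤ 1) →
      ∑ i, ∑ j, a i j * (s i * t j) ≤ N) : GP a (8 * N) := by
  have h0 : GP a (∑ i, ∑ j, |a i j|) := by
    intro d x y hx hy
    refine Finset.sum_le_sum fun i _ => Finset.sum_le_sum fun j _ => ?_
    have h1 : |∑ k, x i k * y j k| ≤ 1 := by
      rw [← sq_le_one_iff_abs_le_one]
      refine (Finset.sum_mul_sq_le_sq_mul_sq _ _ _).trans ?_
      exact mul_le_one₀ (hx i) (Finset.sum_nonneg fun k _ => sq_nonneg _) (hy j)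
    calc _ ≤ |a i j * ∑ k, x i k * y j k| := le_abs_self _
      _ = |a i j| * |∑ k, x i k * y j k| := abs_mul _ _
      _ ≤ _ := mul_le_of_le_one_right (abs_nonneg _) h1
  have hn : ∀ n : ℕ, GP a (8 * N + (∑ i, ∑ j, |a i j| - 8 * N) * (1/2) ^ n) := by
    intro n
    induction n with
    | zero => simpa using h0
    | succ n ih =>
      convert GP.step hN ih using 1
      ring
  intro d x y hx hy
  have ht : Filter.Tendsto (fun n : ℕ => 8 * N + (∑ i, ∑ j, |a i j| - 8 * N) * (1/2) ^ n)
      Filter.atTop (nhds (8 * N + (∑ i, ∑ j, |a i j| - 8 * N) * 0)) :=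
    ((tendsto_pow_atTop_nhds_zero_of_lt_one (by norm_num) (by norm_num)).const_mul _).const_add _
  rw [mul_zero, add_zero] at ht
  exact ge_of_tendsto' ht fun n => hn n d x y hx hy

/-- signs version, Hilbert space form -/
theorem grothendieck_sum {I J : Type*} [Fintype I] [Fintype J] {Z : I → J → ℝ} {N B : ℝ}
    (hN : ∀ s : I → ℝ, (∀ i, s i = 1 ∨ s i = -1) → ∑ j, |∑ i, s i * Z i j| ≤ N)
    {m : ℕ} (h : J → EuclideanSpace ℝ (Fin m)) (hB : 0 ≤ B) (hh : ∀ j, ‖h j‖ ≤ B) :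
    ∑ i, ‖∑ j, Z i j • h j‖ ≤ 8 * N * B := by
  have hN' : ∀ s : I → ℝ, (∀ i, |s i| ≤ 1) → ∑ j, |∑ i, s i * Z i j| ≤ N := by
    intro s hs
    have hc : ConvexOn ℝ Set.univ (fun s : I → ℝ => ∑ j, |∑ i, s i * Z i j|) := by
      refine ⟨convex_univ, fun x _ y _ p q hp hq _ => ?_⟩
      simp only [smul_eq_mul, Finset.mul_sum (s := (Finset.univ : Finset J)),
        ← Finset.sum_add_distrib]
      refine Finset.sum_le_sum fun j _ => ?_
      rw [← abs_of_nonneg hp, ← abs_of_nonneg hq, ← abs_mul, ← abs_mul, abs_of_nonneg hp,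
        abs_of_nonneg hq]
      refine le_of_eq_of_le ?_ (abs_add_le _ _)
      congr 1
      simp only [Finset.mul_sum, ← Finset.sum_add_distrib]
      exact Finset.sum_congr rfl fun i _ => by simp; ring
    have hm : s ∈ convexHull ℝ (Set.univ.pi fun _ : I => ({-1, 1} : Set ℝ)) := by
      rw [convexHull_pi]
      intro i _
      rw [convexHull_pair, segment_eq_Icc (by norm_num)]
      exact abs_le.1 (hs i)
    obtain ⟨y, hy, hle⟩ := (hc.subset (Set.subset_univ _) (convex_convexHull ℝ _)).exists_ge_of_mem_convexHull
      (subset_convexHull ℝ _) hm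
    exact hle.trans (hN y fun i => (hy i trivial).symm)
  have key := grothendieck_ineq (a := Z) (N := N) (fun s t hs ht => by
    refine le_trans ?_ (hN' s hs)
    rw [Finset.sum_comm]
    refine Finset.sum_le_sum fun j _ => ?_
    calc _ = t j * ∑ i, s i * Z i j := by
          rw [Finset.mul_sum]; exact Finset.sum_congr rfl fun i _ => by ring
      _ ≤ |t j * ∑ i, s i * Z i j| := le_abs_self _
      _ = |t j| * |∑ i, s i * Z i j| := abs_mul _ _
      _ ≤ _ := mul_le_of_le_one_left (abs_nonneg _) (ht j))
  rcases hB.eq_or_lt with rfl | hB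
  · have : ∀ j, h j = 0 := fun j => norm_le_zero_iff.1 (hh j)
    simp [this]
  let v : I → EuclideanSpace ℝ (Fin m) := fun i => ∑ j, Z i j • h j
  have k2 := key m (fun i k => (‖v i‖⁻¹ • v i) k) (fun j k => (B⁻¹ • h j) k)
    (fun i => by
      have := EuclideanSpace.real_norm_sq_eq (‖v i‖⁻¹ • v i)
      rw [← this]
      refine pow_le_one₀ (norm_nonneg _) ?_
      rw [norm_smul, norm_inv, norm_norm]
      exact inv_mul_le_one)
    (fun j => by
      have := EuclideanSpace.real_norm_sq_eq (B⁻¹ • h j)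
      rw [← this]
      refine pow_le_one₀ (norm_nonneg _) ?_
      rw [norm_smul, norm_inv, Real.norm_of_nonneg hB.le]
      exact inv_mul_le_one_of_le₀ (hh j) hB.le)
  have e : ∑ i, ∑ j, Z i j * ∑ k, (‖v i‖⁻¹ • v i) k * (B⁻¹ • h j) k = (∑ i, ‖v i‖) / B := by
    rw [Finset.sum_div]
    refine Finset.sum_congr rfl fun i _ => ?_
    have : ∀ j, Z i j * ∑ k, (‖v i‖⁻¹ • v i) k * (B⁻¹ • h j) k
        = ‖v i‖⁻¹ * B⁻¹ * inner ℝ (v i) (Z i j • h j) := by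
      intro j
      rw [inner_smul_right, PiLp.inner_apply, mul_left_comm]
      congr 1
      rw [Finset.mul_sum]
      refine Finset.sum_congr rfl fun k _ => ?_
      simp
      ring
    simp only [this]
    rw [← Finset.mul_sum, ← inner_sum]
    change _ * inner ℝ (v i) (v i) = _
    rw [real_inner_self_eq_norm_sq]
    rcases eq_or_ne ‖v i‖ 0 with h0 | h0
    · simp [h0]
    · field_simp
  rw [e, div_le_iff₀ hB] at k2
  exact k2

theorem l1_coords {X : Type*} [NormedAddCommGroup X] [NormedSpace ℝ X] (hX : IsLpSpace 1 X) :
    ∃ lam : ℝ, 1 ≤ lam ∧ ∀ E : Submodule ℝ X, FiniteDimensional ℝ E →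
      ∃ (m : ℕ) (c : Fin m → (X →ₗ[ℝ] ℝ)) (e : Fin m → X) (α β : ℝ), 0 ≤ α ∧ 0 ≤ β ∧ α * β ≤ lam ∧
        (∀ x ∈ E, ∑ a, |c a x| ≤ α * ‖x‖) ∧ (∀ x ∈ E, x = ∑ a, c a x • e a) ∧
        (∀ a, ‖e a‖ ≤ β) := by
  obtain ⟨lam, h1, h⟩ := hX
  refine ⟨lam, h1, fun E hE => ?_⟩
  obtain ⟨F, hEF, hF, S, hS⟩ := h E hE
  obtain ⟨P, hP⟩ := F.subtype.exists_leftInverse_of_injective (by simp)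
  have hP' : ∀ x (hx : x ∈ F), P x = ⟨x, hx⟩ := fun x hx => by
    have := LinearMap.congr_fun hP ⟨x, hx⟩
    simpa using this
  refine ⟨Module.finrank ℝ F,
    fun a => (PiLp.proj 1 (𝕜 := ℝ) (fun _ : Fin (Module.finrank ℝ F) => ℝ) a).toLinearMap ∘ₗ
      S.toLinearEquiv.toLinearMap ∘ₗ P,
    fun a => (S.symm (PiLp.single 1 a (1:ℝ)) : F), ‖S.toContinuousLinearMap‖, ‖S.symm.toContinuousLinearMap‖,
    ContinuousLinearMap.opNorm_nonneg _, ContinuousLinearMap.opNorm_nonneg _, hS, ?_, ?_, ?_⟩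
  · intro x hx
    have := S.toContinuousLinearMap.le_opNorm ⟨x, hEF hx⟩
    rw [PiLp.norm_eq_of_L1] at this
    simpa [hP' x (hEF hx)] using this
  · intro x hx
    have h2 : S ⟨x, hEF hx⟩ = ∑ a, (S ⟨x, hEF hx⟩ a) • (PiLp.single 1 a (1:ℝ)) := by
      ext b
      simp [Pi.single_apply]
    have h3 := congrArg (fun z => ((S.symm z : F) : X)) h2
    simp only [ContinuousLinearEquiv.symm_apply_apply, map_sum, map_smul, Submodule.coe_sum,
      Submodule.coe_smul] at h3
    simpa [hP' x (hEF hx)] using h3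
  · intro a
    have := S.symm.toContinuousLinearMap.le_opNorm (PiLp.single 1 a (1:ℝ))
    simpa using this

theorem l2_coords {Y : Type*} [NormedAddCommGroup Y] [NormedSpace ℝ Y] (hY : IsLpSpace 2 Y) :
    ∃ lam : ℝ, 1 ≤ lam ∧ ∀ (J : Type) [Fintype J] (y : J → Y),
      ∃ (m : ℕ) (h : J → EuclideanSpace ℝ (Fin m)) (α β : ℝ), 0 ≤ α ∧ 0 ≤ β ∧ α * β ≤ lam ∧
        (∀ j, ‖h j‖ ≤ α * ‖y j‖) ∧ (∀ z : J → ℝ, ‖∑ j, z j • y j‖ ≤ β * ‖∑ j, z j • h j‖) := by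
  obtain ⟨lam, h1, h⟩ := hY
  refine ⟨lam, h1, fun J _ y => ?_⟩
  obtain ⟨F, hEF, hF, S, hS⟩ := h (Submodule.span ℝ (Set.range y))
    (FiniteDimensional.span_of_finite ℝ (Set.finite_range y))
  have hy : ∀ j, y j ∈ F := fun j => hEF (Submodule.subset_span ⟨j, rfl⟩)
  refine ⟨Module.finrank ℝ F, fun j => S ⟨y j, hy j⟩, ‖S.toContinuousLinearMap‖, ‖S.symm.toContinuousLinearMap‖,
    ContinuousLinearMap.opNorm_nonneg _, ContinuousLinearMap.opNorm_nonneg _, hS, ?_, ?_⟩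
  · intro j
    exact S.toContinuousLinearMap.le_opNorm ⟨y j, hy j⟩
  · intro z
    have := S.symm.toContinuousLinearMap.le_opNorm (∑ j, z j • S ⟨y j, hy j⟩)
    simpa [map_sum] using this

open PiTensorProduct in
open scoped TensorProduct in
theorem key_bound {n : ℕ} {X : Fin n → Type*}
    [∀ i, NormedAddCommGroup (X i)] [∀ i, NormedSpace ℝ (X i)]
    {Y : Type*} [NormedAddCommGroup Y] [NormedSpace ℝ Y]
    (T : ContinuousMultilinearMap ℝ X Y) (lamY : ℝ) (lam : Fin n → ℝ) 
    (hY : ∀ (J : Type) [Fintype J] (y : J → Y),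
      ∃ (m : ℕ) (h : J → EuclideanSpace ℝ (Fin m)) (α β : ℝ), 0 ≤ α ∧ 0 ≤ β ∧ α * β ≤ lamY ∧
        (∀ j, ‖h j‖ ≤ α * ‖y j‖) ∧ (∀ z : J → ℝ, ‖∑ j, z j • y j‖ ≤ β * ‖∑ j, z j • h j‖))
    (hX : ∀ i, ∀ E : Submodule ℝ (X i), FiniteDimensional ℝ E →
      ∃ (m : ℕ) (c : Fin m → (X i →ₗ[ℝ] ℝ)) (e : Fin m → X i) (α β : ℝ),
        0 ≤ α ∧ 0 ≤ β ∧ α * β ≤ lam i ∧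
        (∀ x ∈ E, ∑ a, |c a x| ≤ α * ‖x‖) ∧ (∀ x ∈ E, x = ∑ a, c a x • e a) ∧
        (∀ a, ‖e a‖ ≤ β))
    (k : ℕ) (u v : Fin k → ((i : Fin n) → X i)) (W : ℝ) (hW0 : 0 < W)
    (hW : ∀ σ : Fin k → Bool,
      ‖∑ i, (if σ i then (1:ℝ) else -1) • (tprod ℝ (u i) - tprod ℝ (v i))‖ < W) :
    ∑ i, ‖T (u i) - T (v i)‖ ≤ 8 * lamY * (∏ i, lam i) * ‖T‖ * W := by
  classical
  let z : (Fin k → Bool) → ⨂[ℝ] i, X i := fun σ =>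
    ∑ i, (if σ i then (1:ℝ) else -1) • (tprod ℝ (u i) - tprod ℝ (v i))
  have hrep : ∀ σ, ∃ p : FreeAddMonoid (ℝ × Π i, X i), p ∈ lifts (z σ) ∧
      projectiveSeminormAux p < W := by
    intro σ
    have := hW σ
    rw [norm_def] at this
    obtain ⟨p, hp⟩ := exists_lt_of_ciInf_lt this
    exact ⟨p.1, p.2, hp⟩
  choose p hp hpW using hrep
  -- the finite sets of vectors that need to be captured
  let A : ∀ i, Set (X i) := fun i => (Set.range fun r => u r i) ∪ (Set.range fun r => v r i) ∪
    ⋃ σ, Set.image (fun q : ℝ × Π i, X i => q.2 i) {q | q ∈ (p σ).toList}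
  have hA : ∀ i, (A i).Finite := fun i =>
    ((Set.finite_range _).union (Set.finite_range _)).union
      (Set.finite_iUnion fun σ => ((p σ).toList.finite_toSet).image _)
  choose m c e α β hα hβ hαβ hc he heβ using fun i =>
    hX i (Submodule.span ℝ (A i)) (FiniteDimensional.span_of_finite ℝ (hA i))
  have hu : ∀ r i, u r i ∈ Submodule.span ℝ (A i) := fun r i =>
    Submodule.subset_span (Or.inl (Or.inl ⟨r, rfl⟩))
  have hv : ∀ r i, v r i ∈ Submodule.span ℝ (A i) := fun r i =>
    Submodule.subset_span (Or.inl (Or.inr ⟨r, rfl⟩))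
  have hq : ∀ σ, ∀ q ∈ (p σ).toList, ∀ i, q.2 i ∈ Submodule.span ℝ (A i) := fun σ q hq i =>
    Submodule.subset_span (Or.inr (Set.mem_iUnion.2 ⟨σ, q, hq, rfl⟩))
  -- coordinates of tensors
  let Φ : (∀ i, Fin (m i)) → ((⨂[ℝ] i, X i) →ₗ[ℝ] ℝ) := fun a =>
    lift ((MultilinearMap.mkPiAlgebra ℝ (Fin n) ℝ).compLinearMap fun i => c i (a i))
  have hΦ : ∀ a x, Φ a (tprod ℝ x) = ∏ i, c i (a i) (x i) := fun a x => by simp [Φ]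
  have hΦ1 : ∀ x : (i : Fin n) → X i, (∀ i, x i ∈ Submodule.span ℝ (A i)) →
      ∑ a, |Φ a (tprod ℝ x)| ≤ (∏ i, α i) * ∏ i, ‖x i‖ := by
    intro x hx
    simp only [hΦ, Finset.abs_prod]
    rw [← Fintype.prod_sum (fun i b => |c i b (x i)|), ← Finset.prod_mul_distrib]
    exact Finset.prod_le_prod (fun i _ => Finset.sum_nonneg fun _ _ => abs_nonneg _)
      (fun i _ => hc i _ (hx i))
  have hα0 : 0 ≤ ∏ i, α i := Finset.prod_nonneg fun i _ => hα i
  have hΦz : ∀ σ, ∑ a, |Φ a (z σ)| ≤ (∏ i, α i) * W := by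
    intro σ
    have h1 := (mem_lifts_iff _ _).1 (hp σ)
    have h2 : ∀ l : List (ℝ × Π i, X i), (∀ q ∈ l, ∀ i, q.2 i ∈ Submodule.span ℝ (A i)) →
        ∑ a, |Φ a (l.map (fun x ↦ x.1 • ⨂ₜ[ℝ] i, x.2 i)).sum| ≤
          (∏ i, α i) * (l.map (fun p ↦ ‖p.1‖ * ∏ i, ‖p.2 i‖)).sum := by
      intro l
      induction l with
      | nil => simp
      | cons q l ih =>
        intro hl
        simp only [List.map_cons, List.sum_cons, map_add, map_smul, mul_add]
        have h3 := ih fun q hq => hl q (List.mem_cons_of_mem _ hq)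
        have h4 := hΦ1 q.2 (hl q List.mem_cons_self)
        calc _ ≤ ∑ a, (|q.1| * |Φ a (tprod ℝ q.2)| +
                |Φ a (l.map (fun x ↦ x.1 • ⨂ₜ[ℝ] i, x.2 i)).sum|) := by
              refine Finset.sum_le_sum fun a _ => (abs_add_le _ _).trans ?_
              rw [smul_eq_mul, abs_mul]
          _ ≤ _ := by
              rw [Finset.sum_add_distrib, ← Finset.mul_sum]
              refine add_le_add ?_ h3
              rw [mul_left_comm, Real.norm_eq_abs]
              exact mul_le_mul_of_nonneg_left h4 (abs_nonneg _)
    rw [← h1]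
    exact (h2 _ (hq σ)).trans (mul_le_mul_of_nonneg_left (hpW σ).le hα0)
  -- expansion of T
  let y : (∀ i, Fin (m i)) → Y := fun a => T fun i => e i (a i)
  have hT : ∀ x : (i : Fin n) → X i, (∀ i, x i ∈ Submodule.span ℝ (A i)) →
      T x = ∑ a, Φ a (tprod ℝ x) • y a := by
    intro x hx
    have h1 : x = fun i => ∑ b, c i b (x i) • e i b := funext fun i => he i _ (hx i)
    calc T x = T.toMultilinearMap (fun i => ∑ b, c i b (x i) • e i b) := by
          rw [← h1]; rfl
      _ = _ := by
          rw [MultilinearMap.map_sum]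
          refine Finset.sum_congr rfl fun a _ => ?_
          rw [MultilinearMap.map_smul_univ, hΦ]
          rfl
  have hyB : ∀ a, ‖y a‖ ≤ ‖T‖ * ∏ i, β i := fun a =>
    (T.le_opNorm _).trans (mul_le_mul_of_nonneg_left
      (Finset.prod_le_prod (fun i _ => norm_nonneg _) fun i _ => heβ i _) (norm_nonneg _))
  obtain ⟨M, h, αY, βY, hαY, hβY, hYl, hh1, hh2⟩ := hY _ y
  have hβ0 : 0 ≤ ∏ i, β i := Finset.prod_nonneg fun i _ => hβ i
  have hB : 0 ≤ αY * (‖T‖ * ∏ i, β i) := by positivity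
  have G := grothendieck_sum (Z := fun r a => Φ a (tprod ℝ (u r) - tprod ℝ (v r)))
    (N := (∏ i, α i) * W) (fun s hs => by
      convert hΦz (fun i => decide (s i = 1)) using 3 with a
      simp only [z, map_sum, map_smul, smul_eq_mul]
      refine Finset.sum_congr rfl fun i _ => ?_
      rcases hs i with h | h
      · simp [h]
      · have : ¬ ((-1:ℝ) = 1) := by norm_num
        simp [h, this]) h hB
    (fun a => (hh1 a).trans (mul_le_mul_of_nonneg_left (hyB a) hαY))
  calc ∑ i, ‖T (u i) - T (v i)‖
      ≤ ∑ i, βY * ‖∑ a, Φ a (tprod ℝ (u i) - tprod ℝ (v i)) • h a‖ := by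
        refine Finset.sum_le_sum fun i _ => ?_
        rw [hT _ (hu i), hT _ (hv i), ← Finset.sum_sub_distrib]
        simp only [← sub_smul, ← map_sub]
        exact hh2 _
    _ = βY * ∑ i, ‖∑ a, Φ a (tprod ℝ (u i) - tprod ℝ (v i)) • h a‖ := by rw [Finset.mul_sum]
    _ ≤ βY * (8 * ((∏ i, α i) * W) * (αY * (‖T‖ * ∏ i, β i))) :=
        mul_le_mul_of_nonneg_left G hβY
    _ = 8 * (αY * βY) * (∏ i, α i * β i) * ‖T‖ * W := by rw [Finset.prod_mul_distrib]; ring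
    _ ≤ _ := by
        have h1 : ∏ i, α i * β i ≤ ∏ i, lam i :=
          Finset.prod_le_prod (fun i _ => mul_nonneg (hα i) (hβ i)) fun i _ => hαβ i
        have h0 : 0 ≤ ∏ i, α i * β i := Finset.prod_nonneg fun i _ => mul_nonneg (hα i) (hβ i)
        have h3 : 0 ≤ αY * βY := mul_nonneg hαY hβY
        have h4 : 0 ≤ lamY := h3.trans hYl
        gcongr

open PiTensorProduct in
open scoped TensorProduct in
theorem grothendieck_multilinear {n : ℕ} (hn : 1 ≤ n) {X : Fin n → Type*}
    [∀ i, NormedAddCommGroup (X i)] [∀ i, NormedSpace ℝ (X i)] [∀ i, CompleteSpace (X i)]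
    {Y : Type*} [NormedAddCommGroup Y] [NormedSpace ℝ Y] [CompleteSpace Y]
    (hX : ∀ i, IsLpSpace 1 (X i)) (hY : IsLpSpace 2 Y)
    (T : ContinuousMultilinearMap ℝ X Y) :
    ∃ c : ℝ, 0 ≤ c ∧ LipschitzPSumming 1 c T := by
  choose lam hlam hlX using fun i => l1_coords (hX i)
  obtain ⟨lamY, hlamY, hlY⟩ := l2_coords hY
  have hp : 0 ≤ ∏ i, lam i := Finset.prod_nonneg fun i _ => zero_le_one.trans (hlam i)
  have hC : 0 ≤ 8 * lamY * (∏ i, lam i) * ‖T‖ := by positivity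
  refine ⟨_, hC, fun k u v => ?_⟩
  simp only [Real.rpow_one, div_one]
  set f : {φ : ContinuousMultilinearMap ℝ X ℝ // ‖φ‖ ≤ 1} → ℝ :=
    fun φ => ∑ i, |φ.1 (u i) - φ.1 (v i)| with hf
  have hbdd : BddAbove (Set.range f) := by
    refine ⟨∑ i, (∏ j, ‖u i j‖ + ∏ j, ‖v i j‖), ?_⟩
    rintro _ ⟨φ, rfl⟩
    refine Finset.sum_le_sum fun i _ => (abs_sub _ _).trans (add_le_add ?_ ?_)
    · exact (φ.1.le_opNorm _).trans (mul_le_of_le_one_left (by positivity) φ.2)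
    · exact (φ.1.le_opNorm _).trans (mul_le_of_le_one_left (by positivity) φ.2)
  have hW0 : 0 ≤ ⨆ φ, f φ :=
    Real.iSup_nonneg fun φ => Finset.sum_nonneg fun i _ => abs_nonneg _
  have hWσ : ∀ σ : Fin k → Bool,
      ‖∑ i, (if σ i then (1:ℝ) else -1) • (tprod ℝ (u i) - tprod ℝ (v i))‖ ≤ ⨆ φ, f φ := by
    intro σ
    obtain ⟨g, hg1, hg⟩ := exists_dual_vector'' ℝ
      (∑ i, (if σ i then (1:ℝ) else -1) • (tprod ℝ (u i) - tprod ℝ (v i)))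
    have hφ : ‖(liftIsometry ℝ X ℝ).symm g‖ ≤ 1 := by
      rw [LinearIsometryEquiv.norm_map]; exact hg1
    refine le_trans ?_ (le_ciSup hbdd ⟨_, hφ⟩)
    rw [RCLike.ofReal_real_eq_id, id] at hg
    rw [← hg, map_sum]
    refine Finset.sum_le_sum fun i _ => (le_abs_self _).trans ?_
    rw [map_smul, smul_eq_mul, abs_mul, map_sub]
    have : |(if σ i then (1:ℝ) else -1)| = 1 := by split_ifs <;> simp
    rw [this, one_mul]
    apply le_of_eq
    have ht : ∀ x, (liftIsometry ℝ X ℝ).symm g x = g (tprod ℝ x) := fun x => by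
      simp only [liftIsometry_symm_apply, ContinuousLinearMap.compContinuousMultilinearMap_coe,
        Function.comp_apply]
      congr 1
    simp only [ht]
  have hd : ∀ δ > 0, ∑ i, ‖T (u i) - T (v i)‖ ≤
      8 * lamY * (∏ i, lam i) * ‖T‖ * ((⨆ φ, f φ) + δ) := fun δ hδ =>
    key_bound T lamY lam hlY hlX k u v _ (by linarith) fun σ => (hWσ σ).trans_lt (by linarith)
  have ht : Filter.Tendsto (fun δ : ℝ => 8 * lamY * (∏ i, lam i) * ‖T‖ * ((⨆ φ, f φ) + δ))
      (nhdsWithin 0 (Set.Ioi 0)) (nhds (8 * lamY * (∏ i, lam i) * ‖T‖ * ((⨆ φ, f φ) + 0))) :=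
    (Continuous.tendsto (by fun_prop) 0).mono_left nhdsWithin_le_nhds
  rw [add_zero] at ht
  exact ge_of_tendsto ht (Filter.eventually_of_mem self_mem_nhdsWithin fun δ hδ => hd δ hδ)
end

section
/- Let n ≥ 1, let X₁, …, Xₙ be real Banach spaces each of which is an 𝓛₁-space, and let Y be any real Banach space. Then a continuous n-linear operator T : X₁ × ⋯ × Xₙ → Y is Lipschitz 1-summing if and only if it is Lipschitz 2-summing. -/
open scoped BigOperators ENNReal

/-- `X` is an `𝓛₁`-space: for some `λ ≥ 1`, every finite-dimensional subspace is
contained in a finite-dimensional subspace `F` which is `λ`-isomorphic to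
`ℓ₁^{dim F}`. -/
def IsL1Space (X : Type*) [NormedAddCommGroup X] [NormedSpace ℝ X] : Prop :=
  ∃ lam : ℝ, 1 ≤ lam ∧ ∀ E : Submodule ℝ X, FiniteDimensional ℝ E →
    ∃ F : Submodule ℝ X, E ≤ F ∧ FiniteDimensional ℝ F ∧
      ∃ S : F ≃L[ℝ] PiLp 1 (fun _ : Fin (Module.finrank ℝ F) => ℝ),
        ‖S.toContinuousLinearMap‖ * ‖S.symm.toContinuousLinearMap‖ ≤ lam


namespace LipSum

lemma rademacher (m : ℕ) : ∃ (M : ℕ) (_ : 0 < M) (R : (Fin m → ℝ) → Fin M → ℝ),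
    (∀ x y, ∑ w, R x w * R y w = M * ∑ t, x t * y t) ∧
    (∀ x, ∑ w, (R x w) ^ 4 ≤ 3 * M * (∑ t, x t ^ 2) ^ 2) := by
  induction m with
  | zero => exact ⟨1, one_pos, fun _ _ => 0, by simp, by simp⟩
  | succ m ih =>
    obtain ⟨M, hM, R, h1, h2⟩ := ih
    refine ⟨M + M, by omega, fun x => Fin.append (fun w => R (Fin.tail x) w + x 0)
      (fun w => R (Fin.tail x) w - x 0), ?_, ?_⟩
    · intro x y
      simp only [Fin.sum_univ_add, Fin.append_left, Fin.append_right, Fin.sum_univ_succ]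
      rw [← Finset.sum_add_distrib]
      have : ∀ w, (R (Fin.tail x) w + x 0) * (R (Fin.tail y) w + y 0) +
          (R (Fin.tail x) w - x 0) * (R (Fin.tail y) w - y 0)
          = 2 * (R (Fin.tail x) w * R (Fin.tail y) w) + 2 * (x 0 * y 0) := fun w => by ring
      simp only [this, Finset.sum_add_distrib, ← Finset.mul_sum, h1]
      simp [Fin.tail]
      ring
    · intro x
      simp only [Fin.sum_univ_add, Fin.append_left, Fin.append_right, Fin.sum_univ_succ]
      rw [← Finset.sum_add_distrib]
      have : ∀ w, (R (Fin.tail x) w + x 0) ^ 4 + (R (Fin.tail x) w - x 0) ^ 4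
          = 2 * (R (Fin.tail x) w) ^ 4 + 12 * x 0 ^ 2 * (R (Fin.tail x) w * R (Fin.tail x) w)
            + 2 * x 0 ^ 4 := fun w => by ring
      simp only [this, Finset.sum_add_distrib, ← Finset.mul_sum, h1]
      have h3 := h2 (Fin.tail x)
      have h4 : ∑ t, Fin.tail x t * Fin.tail x t = ∑ t : Fin m, x t.succ ^ 2 := by
        simp [Fin.tail, sq]
      have h5 : ∑ t, Fin.tail x t ^ 2 = ∑ t : Fin m, x t.succ ^ 2 := by
        simp [Fin.tail]
      rw [h4]
      rw [h5] at h3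
      set S := ∑ t : Fin m, x t.succ ^ 2
      simp only [Finset.sum_const, Finset.card_univ, Fintype.card_fin, nsmul_eq_mul]
      push_cast
      have h6 : 0 ≤ (M : ℝ) * x 0 ^ 4 := by positivity
      nlinarith

/-- truncation at level 2 -/
lemma trunc (t : ℝ) : |max (-2) (min 2 t)| ≤ 2 ∧ (max (-2) (min 2 t)) ^ 2 ≤ t ^ 2 ∧
    (t - max (-2) (min 2 t)) ^ 2 ≤ t ^ 4 / 64 := by
  have key : ∀ s, 0 ≤ s → s ≤ t ^ 2 / 8 → s ^ 2 ≤ t ^ 4 / 64 := by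
    intro s hs h
    nlinarith
  rcases le_total 2 t with h | h
  · rw [min_eq_left h, max_eq_right (by norm_num)]
    refine ⟨by norm_num, by nlinarith, key _ (by linarith) (by nlinarith [sq_nonneg (t - 4)])⟩
  · rw [min_eq_right h]
    rcases le_total (-2) t with h' | h'
    · rw [max_eq_right h']
      refine ⟨abs_le.2 ⟨h', h⟩, le_rfl, by simp; positivity⟩
    · rw [max_eq_left h']
      refine ⟨by norm_num, by nlinarith, ?_⟩
      rw [← neg_sq]
      exact key _ (by linarith) (by nlinarith [sq_nonneg (t + 4)])

/-- Grothendieck bound on vectors of `ℝ^m`. -/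
def GB {I J : Type*} [Fintype I] [Fintype J] (a : I → J → ℝ) (K : ℝ) : Prop :=
  ∀ (m : ℕ) (x : I → Fin m → ℝ) (y : J → Fin m → ℝ),
    (∀ i, ∑ t, x i t ^ 2 ≤ 1) → (∀ j, ∑ t, y j t ^ 2 ≤ 1) →
    ∑ i, ∑ j, a i j * ∑ t, x i t * y j t ≤ K

lemma GB.scaled {I J : Type*} [Fintype I] [Fintype J] {a : I → J → ℝ} {K : ℝ} (h : GB a K)
    {m : ℕ} (x : I → Fin m → ℝ) (y : J → Fin m → ℝ) {p q : ℝ} (hp : 0 < p) (hq : 0 < q)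
    (hx : ∀ i, ∑ t, x i t ^ 2 ≤ p ^ 2) (hy : ∀ j, ∑ t, y j t ^ 2 ≤ q ^ 2) :
    ∑ i, ∑ j, a i j * ∑ t, x i t * y j t ≤ p * q * K := by
  have := h m (fun i t => x i t / p) (fun j t => y j t / q)
    (fun i => by
      simp only [div_pow, ← Finset.sum_div]
      rw [div_le_one (by positivity)]; exact hx i)
    (fun i => by
      simp only [div_pow, ← Finset.sum_div]
      rw [div_le_one (by positivity)]; exact hy i)
  have e : ∑ i, ∑ j, a i j * ∑ t, x i t / p * (y j t / q)
      = (∑ i, ∑ j, a i j * ∑ t, x i t * y j t) / (p * q) := by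
    simp only [Finset.sum_div]
    refine Finset.sum_congr rfl fun i _ => Finset.sum_congr rfl fun j _ => ?_
    rw [mul_div_assoc, Finset.sum_div]
    congr 1
    refine Finset.sum_congr rfl fun t _ => ?_
    field_simp
  rw [e, div_le_iff₀ (by positivity)] at this
  linarith

lemma GB.improve {I J : Type*} [Fintype I] [Fintype J] {a : I → J → ℝ} {K B : ℝ} (h : GB a K)
    (hB : ∀ (x : I → ℝ) (y : J → ℝ), (∀ i, |x i| ≤ 1) → (∀ j, |y j| ≤ 1) →
      ∑ i, ∑ j, a i j * (x i * y j) ≤ B) : GB a (4 * B + K / 2) := by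
  intro m x y hx hy
  obtain ⟨M, hM, R, h1, h2⟩ := rademacher m
  have hM' : (0 : ℝ) < M := by exact_mod_cast hM
  set τ : ℝ → ℝ := fun t => max (-2) (min 2 t) with hτ
  have sqM : (Real.sqrt M) ^ 2 = M := Real.sq_sqrt hM'.le
  have s0 : 0 < Real.sqrt M := Real.sqrt_pos.2 hM'
  have nrm : ∀ z : Fin m → ℝ, ∑ t, z t ^ 2 ≤ 1 → ∑ w, R z w ^ 2 ≤ (Real.sqrt M) ^ 2 := by
    intro z hz
    have := h1 z z
    simp only [← sq] at this
    rw [this, sqM]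
    nlinarith
  have nrmτ : ∀ z : Fin m → ℝ, ∑ t, z t ^ 2 ≤ 1 → ∑ w, τ (R z w) ^ 2 ≤ (Real.sqrt M) ^ 2 :=
    fun z hz => (Finset.sum_le_sum fun w _ => (trunc (R z w)).2.1).trans (nrm z hz)
  have nrmr : ∀ z : Fin m → ℝ, ∑ t, z t ^ 2 ≤ 1 →
      ∑ w, (R z w - τ (R z w)) ^ 2 ≤ (Real.sqrt M / 4) ^ 2 := by
    intro z hz
    refine (Finset.sum_le_sum fun w _ => (trunc (R z w)).2.2).trans ?_
    rw [← Finset.sum_div, div_pow, sqM]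
    have h3 := h2 z
    have h4 : (0:ℝ) ≤ ∑ t, z t ^ 2 := Finset.sum_nonneg fun t _ => sq_nonneg _
    have h5 : (∑ t, z t ^ 2) ^ 2 ≤ 1 := by nlinarith
    have h6 : 3 * (M:ℝ) * (∑ t, z t ^ 2) ^ 2 ≤ 3 * M * 1 := by gcongr
    linarith
  have A1 : ∑ i, ∑ j, a i j * ∑ w, τ (R (x i) w) * τ (R (y j) w) ≤ M * (4 * B) := by
    have e : ∑ i, ∑ j, a i j * ∑ w, τ (R (x i) w) * τ (R (y j) w)
        = ∑ w, 4 * ∑ i, ∑ j, a i j * ((τ (R (x i) w) / 2) * (τ (R (y j) w) / 2)) := by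
      simp only [Finset.mul_sum]
      rw [Finset.sum_comm]
      rw [Finset.sum_comm' (t' := Finset.univ) (s' := fun _ => Finset.univ) (by simp)]
      simp_rw [Finset.sum_comm (s := (Finset.univ : Finset J))]
      rw [Finset.sum_comm]
      refine Finset.sum_congr rfl fun w _ => Finset.sum_congr rfl fun i _ =>
        Finset.sum_congr rfl fun j _ => ?_
      ring
    rw [e]
    have : ∀ w ∈ (Finset.univ : Finset (Fin M)),
        4 * ∑ i, ∑ j, a i j * ((τ (R (x i) w) / 2) * (τ (R (y j) w) / 2)) ≤ 4 * B := by
      intro w _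
      have := hB (fun i => τ (R (x i) w) / 2) (fun j => τ (R (y j) w) / 2)
        (fun i => by
          rw [abs_div, abs_two, div_le_one (by norm_num)]; exact (trunc _).1)
        (fun i => by
          rw [abs_div, abs_two, div_le_one (by norm_num)]; exact (trunc _).1)
      linarith
    refine (Finset.sum_le_sum this).trans ?_
    simp
  have A2 := h.scaled (fun i w => R (x i) w - τ (R (x i) w)) (fun j w => τ (R (y j) w))
    (p := Real.sqrt M / 4) (q := Real.sqrt M) (by positivity) s0
    (fun i => nrmr _ (hx i)) (fun j => nrmτ _ (hy j))
  have A3 := h.scaled (fun i w => R (x i) w) (fun j w => R (y j) w - τ (R (y j) w))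
    (p := Real.sqrt M) (q := Real.sqrt M / 4) s0 (by positivity)
    (fun i => nrm _ (hx i)) (fun j => nrmr _ (hy j))
  have E : (M:ℝ) * ∑ i, ∑ j, a i j * ∑ t, x i t * y j t
      = ∑ i, ∑ j, a i j * ∑ w, τ (R (x i) w) * τ (R (y j) w)
      + ∑ i, ∑ j, a i j * ∑ w, (R (x i) w - τ (R (x i) w)) * τ (R (y j) w)
      + ∑ i, ∑ j, a i j * ∑ w, R (x i) w * (R (y j) w - τ (R (y j) w)) := by
    simp only [← Finset.sum_add_distrib, Finset.mul_sum (a := (M:ℝ))]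
    refine Finset.sum_congr rfl fun i _ => Finset.sum_congr rfl fun j _ => ?_
    rw [mul_left_comm, ← h1, ← mul_add, ← mul_add, ← Finset.sum_add_distrib,
      ← Finset.sum_add_distrib]
    congr 1
    refine Finset.sum_congr rfl fun w _ => ?_
    ring
  have F : (M:ℝ) * ∑ i, ∑ j, a i j * ∑ t, x i t * y j t ≤ M * (4 * B + K / 2) := by
    rw [E]
    have e1 : Real.sqrt M / 4 * Real.sqrt M * K = M * K / 4 := by linear_combination (K / 4) * sqM
    have e2 : Real.sqrt M * (Real.sqrt M / 4) * K = M * K / 4 := by rw [← e1]; ring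
    rw [e1] at A2
    rw [e2] at A3
    linarith
  exact le_of_mul_le_mul_left F hM'

lemma GB.start {I J : Type*} [Fintype I] [Fintype J] (a : I → J → ℝ) :
    GB a (∑ i, ∑ j, |a i j|) := by
  intro m x y hx hy
  refine Finset.sum_le_sum fun i _ => Finset.sum_le_sum fun j _ => ?_
  have h1 : |∑ t, x i t * y j t| ≤ 1 := by
    rw [← sq_le_one_iff_abs_le_one]
    have := Finset.sum_mul_sq_le_sq_mul_sq Finset.univ (x i) (y j)
    have h3 : (0:ℝ) ≤ ∑ t, x i t ^ 2 := Finset.sum_nonneg fun t _ => sq_nonneg _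
    have h4 : (0:ℝ) ≤ ∑ t, y j t ^ 2 := Finset.sum_nonneg fun t _ => sq_nonneg _
    nlinarith [hx i, hy j]
  refine (le_abs_self _).trans ?_
  rw [abs_mul]
  exact mul_le_of_le_one_right (abs_nonneg _) h1

lemma grothendieck {I J : Type*} [Fintype I] [Fintype J] {a : I → J → ℝ} {B : ℝ}
    (hB : ∀ (x : I → ℝ) (y : J → ℝ), (∀ i, |x i| ≤ 1) → (∀ j, |y j| ≤ 1) →
      ∑ i, ∑ j, a i j * (x i * y j) ≤ B) : GB a (8 * B) := by
  have key : ∀ r : ℕ, GB a (8 * B + (∑ i, ∑ j, |a i j| - 8 * B) * (1 / 2) ^ r) := by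
    intro r
    induction r with
    | zero => simpa using GB.start a
    | succ r ih =>
      have := ih.improve hB
      convert this using 1
      ring
  intro m x y hx hy
  have lim : Filter.Tendsto (fun r : ℕ => 8 * B + (∑ i, ∑ j, |a i j| - 8 * B) * (1 / 2 : ℝ) ^ r)
      Filter.atTop (nhds (8 * B + (∑ i, ∑ j, |a i j| - 8 * B) * 0)) :=
    ((tendsto_pow_atTop_nhds_zero_of_lt_one (by norm_num) (by norm_num)).const_mul _).const_add _
  have := ge_of_tendsto' lim fun r => key r m x y hx hy
  simpa using this

/-- Grothendieck's theorem : `ℓ₁ → ℓ₂` operators are absolutely summing. -/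
lemma grothendieck' {I J : Type*} [Fintype I] [Fintype J] {a : I → J → ℝ} {B : ℝ}
    (hB : ∀ (y : J → ℝ), (∀ j, |y j| ≤ 1) → ∑ i, |∑ j, a i j * y j| ≤ B)
    {m : ℕ} (y : J → Fin m → ℝ) (hy : ∀ j, ∑ t, y j t ^ 2 ≤ 1) :
    ∑ i, Real.sqrt (∑ t, (∑ j, a i j * y j t) ^ 2) ≤ 8 * B := by
  have G : GB a (8 * B) := by
    apply grothendieck
    intro x y hx hy
    refine le_trans (Finset.sum_le_sum fun i _ => ?_) (hB y hy)
    have : ∑ j, a i j * (x i * y j) = x i * ∑ j, a i j * y j := by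
      rw [Finset.mul_sum]
      exact Finset.sum_congr rfl fun j _ => by ring
    rw [this]
    refine (le_abs_self _).trans ?_
    rw [abs_mul]
    exact mul_le_of_le_one_left (abs_nonneg _) (hx i)
  set D : I → ℝ := fun i => Real.sqrt (∑ t, (∑ j, a i j * y j t) ^ 2) with hD
  have nn : ∀ i, 0 ≤ ∑ t, (∑ j, a i j * y j t) ^ 2 :=
    fun i => Finset.sum_nonneg fun t _ => sq_nonneg _
  have Dsq : ∀ i, D i ^ 2 = ∑ t, (∑ j, a i j * y j t) ^ 2 := fun i => Real.sq_sqrt (nn i)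
  have := G m (fun i t => (∑ j, a i j * y j t) / D i) y (fun i => by
    simp only [div_pow, ← Finset.sum_div]
    rw [← Dsq]
    exact div_self_le_one _) hy
  refine le_trans (le_of_eq ?_) this
  refine Finset.sum_congr rfl fun i _ => ?_
  have e : ∑ j, a i j * ∑ t, (∑ j, a i j * y j t) / D i * y j t
      = (∑ t, (∑ j, a i j * y j t) ^ 2) / D i := by
    have : ∀ j, a i j * ∑ t, (∑ j, a i j * y j t) / D i * y j t
        = ∑ t, (∑ j, a i j * y j t) / D i * (a i j * y j t) := fun j => by
      rw [Finset.mul_sum]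
      exact Finset.sum_congr rfl fun t _ => by ring
    simp only [this]
    rw [Finset.sum_comm, Finset.sum_div]
    refine Finset.sum_congr rfl fun t _ => ?_
    rw [← Finset.mul_sum]
    ring
  rw [e, ← Dsq, sq, mul_self_div_self]

end LipSum

namespace LipSum

lemma separation {Φ : Type*} [Nonempty Φ] {k : ℕ} (h : Φ → Fin k → ℝ) (t : Fin k → ℝ)
    (H : ∀ w : Fin k → ℝ, (∀ i, 0 ≤ w i) → ∀ M, (∀ φ, ∑ i, w i * h φ i ≤ M) →
      ∑ i, w i * t i ≤ M) {ε : ℝ} (hε : 0 < ε) :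
    ∃ z ∈ convexHull ℝ (Set.range h), ∀ i, t i < z i + ε := by
  by_contra hcon
  set C : Set (Fin k → ℝ) := {x | ∃ z ∈ convexHull ℝ (Set.range h), ∀ i, x i < z i + ε} with hC
  have hconv : Convex ℝ C := by
    rintro x ⟨z, hz, hxz⟩ x' ⟨z', hz', hxz'⟩ p q hp hq hpq
    refine ⟨p • z + q • z', convex_convexHull ℝ _ hz hz' hp hq hpq, fun i => ?_⟩
    simp only [Pi.add_apply, Pi.smul_apply, smul_eq_mul]
    have h1 := hxz i
    have h2 := hxz' i
    obtain rfl : q = 1 - p := by linarith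
    rcases hp.eq_or_lt with h0 | h0
    · subst h0; simpa using h2
    · nlinarith
  have hopen : IsOpen C := by
    have : C = ⋃ z ∈ convexHull ℝ (Set.range h), {x : Fin k → ℝ | ∀ i, x i < z i + ε} := by
      ext x; simp [hC]
    rw [this]
    refine isOpen_biUnion fun z _ => ?_
    simp only [Set.ofPred_forall]
    exact isOpen_iInter_of_finite fun i => isOpen_lt (continuous_apply i) continuous_const
  obtain ⟨f, hf⟩ := geometric_hahn_banach_open_point hconv hopen (x := t) hcon
  set w : Fin k → ℝ := fun i => f (Pi.single i 1) with hw
  have fw : ∀ x : Fin k → ℝ, f x = ∑ i, w i * x i := by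
    intro x
    conv_lhs => rw [pi_eq_sum_univ' x]
    simp only [map_sum, map_smul, smul_eq_mul, hw, mul_comm]
  have hmem : ∀ φ, h φ ∈ C := fun φ =>
    ⟨h φ, subset_convexHull ℝ _ ⟨φ, rfl⟩, fun i => by linarith⟩
  obtain ⟨φ₀⟩ := ‹Nonempty Φ›
  have hw0 : ∀ i, 0 ≤ w i := by
    intro i
    by_contra hneg
    push Not at hneg
    have hs : ∀ s : ℝ, 0 ≤ s → f (h φ₀) - s * w i < f t := by
      intro s hs
      have hm : h φ₀ - s • Pi.single i (1:ℝ) ∈ C := by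
        refine ⟨h φ₀, subset_convexHull ℝ _ ⟨φ₀, rfl⟩, fun j => ?_⟩
        have : (0:ℝ) ≤ s * (Pi.single i (1:ℝ) : Fin k → ℝ) j := by
          refine mul_nonneg hs ?_
          rw [Pi.single_apply]; split_ifs <;> norm_num
        simp only [Pi.sub_apply, Pi.smul_apply, smul_eq_mul]
        linarith
      have := hf _ hm
      rw [map_sub, map_smul, smul_eq_mul] at this
      exact this
    have h1 := hf _ (hmem φ₀)
    have h2 := hs ((f t - f (h φ₀)) / (-w i)) (div_nonneg (by linarith) (by linarith))
    have h3 : (f t - f (h φ₀)) / (-w i) * w i = -(f t - f (h φ₀)) := by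
      have := hneg.ne
      rw [div_neg, neg_mul, div_mul_cancel₀ _ this]
    rw [h3] at h2
    linarith
  have wpos : 0 < ∑ i, w i := by
    rcases (Finset.sum_nonneg fun i (_ : i ∈ Finset.univ) => hw0 i).eq_or_lt with h0 | h0
    · exfalso
      have := (Finset.sum_eq_zero_iff_of_nonneg fun i _ => hw0 i).1 h0.symm
      have h1 := hf _ (hmem φ₀)
      rw [fw, fw, Finset.sum_eq_zero (fun i hi => by rw [this i hi, zero_mul]),
        Finset.sum_eq_zero (fun i hi => by rw [this i hi, zero_mul])] at h1
      exact lt_irrefl _ h1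
    · exact h0
  have := H w hw0 (∑ i, w i * t i - (ε / 2) * ∑ i, w i) (fun φ => by
    have hm : (fun i => h φ i + ε / 2) ∈ C :=
      ⟨h φ, subset_convexHull ℝ _ ⟨φ, rfl⟩, fun i => by dsimp only; linarith⟩
    have := hf _ hm
    rw [fw, fw] at this
    simp only [mul_add, Finset.sum_add_distrib, ← Finset.sum_mul] at this
    linarith)
  nlinarith

lemma compactness {n k : ℕ} {X : Fin n → Type*} [∀ i, NormedAddCommGroup (X i)]
    [∀ i, NormedSpace ℝ (X i)] {C L : ℝ} (hC : 0 ≤ C) (u v : Fin k → ∀ l, X l)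
    (H : ∀ Q : Finset (∀ l, X l), ∃ ψ : MultilinearMap ℝ X ℝ,
      (∀ m ∈ Q, |ψ m| ≤ C * ∏ l, ‖m l‖) ∧ L ≤ ∑ i, |ψ (u i) - ψ (v i)|) :
    ∃ φ : ContinuousMultilinearMap ℝ X ℝ, ‖φ‖ ≤ C ∧ L ≤ ∑ i, |φ (u i) - φ (v i)| := by
  classical
  choose Ψ h1 h2 using H
  let U : Ultrafilter (Finset (∀ l, X l)) := Ultrafilter.of Filter.atTop
  have hU : (U : Filter (Finset (∀ l, X l))) ≤ Filter.atTop := Ultrafilter.of_le _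
  have ev : ∀ m : ∀ l, X l, ∀ᶠ Q in (U : Filter _), |Ψ Q m| ≤ C * ∏ l, ‖m l‖ := by
    intro m
    refine hU ?_
    filter_upwards [Filter.eventually_ge_atTop ({m} : Finset (∀ l, X l))] with Q hQ
    exact h1 Q m (hQ (by simp))
  have lim : ∀ m : ∀ l, X l, ∃ g : ℝ, Filter.Tendsto (fun Q => Ψ Q m) U (nhds g) := by
    intro m
    have hc : IsCompact (Set.Icc (-(C * ∏ l, ‖m l‖)) (C * ∏ l, ‖m l‖)) := isCompact_Icc
    obtain ⟨g, -, hg⟩ := hc.ultrafilter_le_nhds (U.map fun Q => Ψ Q m) (by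
      rw [Filter.le_principal_iff]
      exact (ev m).mono fun Q hQ => abs_le.1 hQ)
    exact ⟨g, hg⟩
  choose g hg using lim
  let G : MultilinearMap ℝ X ℝ :=
    { toFun := g
      map_update_add' := by
        intro inst m i x y
        obtain rfl : inst = instDecidableEqFin n := Subsingleton.elim _ _
        refine tendsto_nhds_unique (hg _) ?_
        simp only [MultilinearMap.map_update_add]
        exact (hg _).add (hg _)
      map_update_smul' := by
        intro inst m i c x
        obtain rfl : inst = instDecidableEqFin n := Subsingleton.elim _ _
        refine tendsto_nhds_unique (hg _) ?_
        simp only [MultilinearMap.map_update_smul]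
        exact (hg _).const_smul c }
  have hb : ∀ m, ‖G m‖ ≤ C * ∏ l, ‖m l‖ := by
    intro m
    exact le_of_tendsto (hg m).abs (ev m)
  refine ⟨G.mkContinuous C hb, G.mkContinuous_norm_le hC hb, ?_⟩
  refine ge_of_tendsto (tendsto_finsetSum Finset.univ fun i _ => ((hg (u i)).sub (hg (v i))).abs) ?_
  exact Filter.Eventually.of_forall fun Q => h2 Q

lemma l1_local {X : Type*} [NormedAddCommGroup X] [NormedSpace ℝ X] (h : IsL1Space X) :
    ∃ lam : ℝ, 0 ≤ lam ∧ ∀ Q : Finset X, ∃ (d : ℕ) (e : Fin d → X) (f : X →ₗ[ℝ] (Fin d → ℝ)),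
      (∀ s, ‖e s‖ ≤ 1) ∧ ∀ x ∈ Q, x = ∑ s, f x s • e s ∧ ∑ s, |f x s| ≤ lam * ‖x‖ := by
  obtain ⟨lam, hl, H⟩ := h
  refine ⟨lam, by linarith, fun Q => ?_⟩
  obtain ⟨F, hEF, hF, S, hS⟩ := H (Submodule.span ℝ (Q : Set X))
    (FiniteDimensional.span_finset ℝ Q)
  set β := ‖S.symm.toContinuousLinearMap‖ with hβ
  have hβ0 : 0 ≤ β := ContinuousLinearMap.opNorm_nonneg _
  let S' : F →ₗ[ℝ] (Fin (Module.finrank ℝ F) → ℝ) :=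
    (WithLp.linearEquiv 1 ℝ (Fin (Module.finrank ℝ F) → ℝ)).toLinearMap ∘ₗ S.toLinearEquiv.toLinearMap
  obtain ⟨g, hg⟩ := LinearMap.exists_extend S'
  have hgx : ∀ (x : F) s, g x s = (S x) s := by
    intro x s
    have := LinearMap.congr_fun hg x
    simp only [LinearMap.comp_apply, Submodule.subtype_apply] at this
    rw [this]; rfl
  refine ⟨Module.finrank ℝ F, fun s => β⁻¹ • (S.symm (WithLp.toLp 1 (Pi.single s 1)) : X), β • g,
    fun s => ?_, fun x hx => ?_⟩
  · rw [norm_smul, norm_inv, Real.norm_of_nonneg hβ0]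
    have h1 : ‖(S.symm (WithLp.toLp 1 (Pi.single s (1:ℝ))) : X)‖ ≤ β * 1 := by
      refine (S.symm.toContinuousLinearMap.le_opNorm (WithLp.toLp 1 (Pi.single s (1:ℝ)))).trans ?_
      gcongr
      have := PiLp.norm_single (p := 1) (β := fun _ : Fin (Module.finrank ℝ F) => ℝ) s (1:ℝ)
      exact this.le.trans (by simp)
    calc β⁻¹ * _ ≤ β⁻¹ * (β * 1) := by gcongr
      _ ≤ 1 := by rw [mul_one]; exact inv_mul_le_one
  · have hxF : x ∈ F := hEF (Submodule.subset_span hx)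
    obtain ⟨y, rfl⟩ : ∃ y : F, (y : X) = x := ⟨⟨x, hxF⟩, rfl⟩
    constructor
    · have hy : ‖y‖ ≤ β * ‖S y‖ := by
        have := S.symm.toContinuousLinearMap.le_opNorm (S y)
        simpa using this
      rcases hβ0.eq_or_lt with h0 | h0
      · rw [← h0, zero_mul] at hy
        have : y = 0 := by simpa using hy
        simp [this]
      · have e : S y = ∑ s, (S y) s • WithLp.toLp 1 (Pi.single s (1:ℝ)) := by
          ext j
          simp [Pi.single_apply]
        have e2 : y = ∑ s, (S y) s • S.symm (WithLp.toLp 1 (Pi.single s (1:ℝ))) := by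
          conv_lhs => rw [← S.symm_apply_apply y, e]
          simp only [map_sum, map_smul]
        conv_lhs => rw [e2]
        rw [Submodule.coe_sum]
        refine Finset.sum_congr rfl fun s _ => ?_
        rw [LinearMap.smul_apply, Pi.smul_apply, hgx, smul_smul, smul_eq_mul, mul_comm β,
          mul_assoc, mul_inv_cancel₀ h0.ne', mul_one]
        rfl
    · have h1 : ‖S y‖ = ∑ s, |(S y) s| := by
        rw [PiLp.norm_eq_sum (by norm_num)]
        simp
      have h2 : ‖S y‖ ≤ ‖S.toContinuousLinearMap‖ * ‖y‖ := S.toContinuousLinearMap.le_opNorm y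
      simp only [LinearMap.smul_apply, Pi.smul_apply, hgx, smul_eq_mul, abs_mul, abs_of_nonneg hβ0,
        ← Finset.mul_sum, ← h1]
      calc β * ‖S y‖ ≤ β * (‖S.toContinuousLinearMap‖ * ‖y‖) := by gcongr
        _ = (‖S.toContinuousLinearMap‖ * β) * ‖y‖ := by ring
        _ ≤ lam * ‖y‖ := by gcongr

end LipSum

namespace LipSum

lemma local_form {n k N : ℕ} {X : Fin n → Type*} [∀ i, NormedAddCommGroup (X i)]
    [∀ i, NormedSpace ℝ (X i)] (lam : Fin n → ℝ)
    (hlam : ∀ l, ∀ Q : Finset (X l), ∃ (d : ℕ) (e : Fin d → X l) (f : X l →ₗ[ℝ] (Fin d → ℝ)),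
      (∀ s, ‖e s‖ ≤ 1) ∧ ∀ x ∈ Q, x = ∑ s, f x s • e s ∧ ∑ s, |f x s| ≤ lam l * ‖x‖)
    (u v : Fin k → ∀ l, X l) (φ : Fin N → ContinuousMultilinearMap ℝ X ℝ) (hφ : ∀ j, ‖φ j‖ ≤ 1)
    (ν : Fin N → ℝ) (hν : ∀ j, 0 ≤ ν j) (hν1 : ∑ j, ν j = 1) (Q : Finset (∀ l, X l)) :
    ∃ ψ : MultilinearMap ℝ X ℝ, (∀ m ∈ Q, |ψ m| ≤ (∏ l, lam l) * ∏ l, ‖m l‖) ∧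
      (∑ i, Real.sqrt (∑ j, ν j * (φ j (u i) - φ j (v i)) ^ 2)) / 9
        ≤ ∑ i, |ψ (u i) - ψ (v i)| := by
  classical
  set Q' : Finset (∀ l, X l) := Q ∪ (Finset.univ.image u ∪ Finset.univ.image v) with hQ'
  choose d e f he hf using fun l => hlam l (Q'.image fun m => m l)
  have hf' : ∀ m ∈ Q', ∀ l, m l = ∑ s, f l (m l) s • e l s ∧ ∑ s, |f l (m l) s| ≤ lam l * ‖m l‖ :=
    fun m hm l => hf l (m l) (Finset.mem_image_of_mem _ hm)
  have hu : ∀ i, u i ∈ Q' := fun i => by simp [hQ']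
  have hv : ∀ i, v i ∈ Q' := fun i => by simp [hQ']
  let P : (∀ l, Fin (d l)) → (∀ l, X l) → ℝ := fun s m => ∏ l, f l (m l) (s l)
  have hexp : ∀ j, ∀ m ∈ Q', φ j m = ∑ s, P s m * φ j (fun l => e l (s l)) := by
    intro j m hm
    have : m = fun l => ∑ s, f l (m l) s • e l s := funext fun l => (hf' m hm l).1
    conv_lhs => rw [this]
    rw [ContinuousMultilinearMap.map_sum]
    refine Finset.sum_congr rfl fun s _ => ?_
    rw [ContinuousMultilinearMap.map_smul_univ, smul_eq_mul]
  let Ψ : ((∀ l, Fin (d l)) → ℝ) → MultilinearMap ℝ X ℝ := fun σ =>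
    ∑ s, σ s • (MultilinearMap.mkPiAlgebra ℝ (Fin n) ℝ).compLinearMap
      (fun l => LinearMap.proj (s l) ∘ₗ f l)
  have hΨ : ∀ σ m, Ψ σ m = ∑ s, P s m * σ s := by
    intro σ m
    simp [Ψ, P, mul_comm]
  have hΨb : ∀ σ, (∀ s, |σ s| ≤ 1) → ∀ m ∈ Q, |Ψ σ m| ≤ (∏ l, lam l) * ∏ l, ‖m l‖ := by
    intro σ hσ m hm
    have hm' : m ∈ Q' := by simp [hQ', hm]
    rw [hΨ]
    calc |∑ s, P s m * σ s| ≤ ∑ s, |P s m * σ s| := Finset.abs_sum_le_sum_abs _ _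
      _ ≤ ∑ s : ∀ l, Fin (d l), ∏ l, |f l (m l) (s l)| := by
        refine Finset.sum_le_sum fun s _ => ?_
        rw [abs_mul, ← Finset.abs_prod]
        exact mul_le_of_le_one_right (abs_nonneg _) (hσ s)
      _ = ∏ l, ∑ s, |f l (m l) s| := by
        rw [Finset.prod_univ_sum, Fintype.piFinset_univ]
      _ ≤ ∏ l, (lam l * ‖m l‖) :=
        Finset.prod_le_prod (fun l _ => Finset.sum_nonneg fun s _ => abs_nonneg _)
          fun l _ => (hf' m hm' l).2
      _ = _ := Finset.prod_mul_distrib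
  by_contra hcon
  push Not at hcon
  set L := ∑ i, Real.sqrt (∑ j, ν j * (φ j (u i) - φ j (v i)) ^ 2) with hL
  have hlt : ∀ σ, (∀ s, |σ s| ≤ 1) → ∑ i, |Ψ σ (u i) - Ψ σ (v i)| < L / 9 :=
    fun σ hσ => hcon (Ψ σ) (hΨb σ hσ)
  have hpos : 0 < L := by
    have := hlt 0 (by simp)
    have h0 : (0:ℝ) ≤ ∑ i, |Ψ 0 (u i) - Ψ 0 (v i)| := Finset.sum_nonneg fun i _ => abs_nonneg _
    linarith
  have G := grothendieck' (a := fun i s => P s (u i) - P s (v i)) (B := L / 9)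
    (fun σ hσ => by
      refine le_trans (le_of_eq ?_) (hlt σ hσ).le
      refine Finset.sum_congr rfl fun i _ => ?_
      rw [hΨ, hΨ, ← Finset.sum_sub_distrib]
      simp only [sub_mul])
    (fun s (j : Fin N) => Real.sqrt (ν j) * φ j (fun l => e l (s l)))
    (fun s => by
      rw [← hν1]
      refine Finset.sum_le_sum fun j _ => ?_
      rw [mul_pow, Real.sq_sqrt (hν j)]
      refine mul_le_of_le_one_right (hν j) ?_
      rw [sq_le_one_iff_abs_le_one, ← Real.norm_eq_abs]
      refine ((φ j).le_opNorm _).trans ?_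
      refine mul_le_one₀ (hφ j) (Finset.prod_nonneg fun l _ => norm_nonneg _) ?_
      exact Finset.prod_le_one (fun l _ => norm_nonneg _) fun l _ => he l (s l))
  have e1 : ∑ i, Real.sqrt (∑ j : Fin N, (∑ s, (P s (u i) - P s (v i)) *
      (Real.sqrt (ν j) * φ j (fun l => e l (s l)))) ^ 2) = L := by
    refine Finset.sum_congr rfl fun i _ => ?_
    congr 1
    refine Finset.sum_congr rfl fun j _ => ?_
    have : ∑ s, (P s (u i) - P s (v i)) * (Real.sqrt (ν j) * φ j (fun l => e l (s l)))
        = Real.sqrt (ν j) * (φ j (u i) - φ j (v i)) := by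
      rw [hexp j _ (hu i), hexp j _ (hv i), ← Finset.sum_sub_distrib, Finset.mul_sum]
      exact Finset.sum_congr rfl fun s _ => by ring
    rw [this, mul_pow, Real.sq_sqrt (hν j)]
  rw [e1] at G
  linarith

section
variable {n k : ℕ} {X : Fin n → Type*} [∀ i, NormedAddCommGroup (X i)]
    [∀ i, NormedSpace ℝ (X i)] {Y : Type*} [NormedAddCommGroup Y] [NormedSpace ℝ Y]

lemma abs_le_of_ball (φ : ContinuousMultilinearMap ℝ X ℝ) (h : ‖φ‖ ≤ 1) (a b : ∀ l, X l) :
    |φ a - φ b| ≤ ∏ l, ‖a l‖ + ∏ l, ‖b l‖ := by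
  have key : ∀ m, |φ m| ≤ ∏ l, ‖m l‖ := fun m =>
    (φ.le_opNorm m).trans (mul_le_of_le_one_left (Finset.prod_nonneg fun l _ => norm_nonneg _) h)
  exact (abs_sub _ _).trans (add_le_add (key a) (key b))

lemma bdd1 (u v : Fin k → ∀ l, X l) :
    BddAbove (Set.range fun φ : {φ : ContinuousMultilinearMap ℝ X ℝ // ‖φ‖ ≤ 1} =>
      ∑ i, |φ.1 (u i) - φ.1 (v i)|) := by
  refine ⟨∑ i, (∏ l, ‖u i l‖ + ∏ l, ‖v i l‖), ?_⟩
  rintro _ ⟨φ, rfl⟩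
  exact Finset.sum_le_sum fun i _ => abs_le_of_ball φ.1 φ.2 _ _

lemma nonempty_ball : Nonempty {φ : ContinuousMultilinearMap ℝ X ℝ // ‖φ‖ ≤ 1} :=
  ⟨⟨0, by simp⟩⟩

lemma lip1_iff {c : ℝ} (hc : 0 ≤ c) (T : ContinuousMultilinearMap ℝ X Y) :
    LipschitzPSumming 1 c T ↔ ∀ (k : ℕ) (u v : Fin k → ∀ l, X l) (M : ℝ),
      (∀ φ : ContinuousMultilinearMap ℝ X ℝ, ‖φ‖ ≤ 1 → ∑ i, |φ (u i) - φ (v i)| ≤ M) →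
      ∑ i, ‖T (u i) - T (v i)‖ ≤ c * M := by
  have := nonempty_ball (X := X)
  unfold LipschitzPSumming
  simp only [Real.rpow_one, div_one]
  constructor
  · intro h k u v M hM
    refine (h k u v).trans ?_
    gcongr
    exact ciSup_le fun φ => hM φ.1 φ.2
  · intro h k u v
    exact h k u v _ fun φ hφ => le_ciSup (bdd1 u v) ⟨φ, hφ⟩

lemma bdd2 (u v : Fin k → ∀ l, X l) :
    BddAbove (Set.range fun φ : {φ : ContinuousMultilinearMap ℝ X ℝ // ‖φ‖ ≤ 1} =>
      Real.sqrt (∑ i, |φ.1 (u i) - φ.1 (v i)| ^ 2)) := by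
  refine ⟨Real.sqrt (∑ i, (∏ l, ‖u i l‖ + ∏ l, ‖v i l‖) ^ 2), ?_⟩
  rintro _ ⟨φ, rfl⟩
  exact Real.sqrt_le_sqrt (Finset.sum_le_sum fun i _ =>
    pow_le_pow_left₀ (abs_nonneg _) (abs_le_of_ball φ.1 φ.2 _ _) 2)

lemma lip2_iff {c : ℝ} (hc : 0 ≤ c) (T : ContinuousMultilinearMap ℝ X Y) :
    LipschitzPSumming 2 c T ↔ ∀ (k : ℕ) (u v : Fin k → ∀ l, X l) (M : ℝ), 0 ≤ M →
      (∀ φ : ContinuousMultilinearMap ℝ X ℝ, ‖φ‖ ≤ 1 → ∑ i, (φ (u i) - φ (v i)) ^ 2 ≤ M ^ 2) →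
      ∑ i, ‖T (u i) - T (v i)‖ ^ 2 ≤ (c * M) ^ 2 := by
  have := nonempty_ball (X := X)
  unfold LipschitzPSumming
  simp only [Real.rpow_ofNat, ← Real.sqrt_eq_rpow]
  constructor
  · intro h k u v M hM0 hM
    rw [← Real.sqrt_le_left (by positivity)]
    refine (h k u v).trans ?_
    gcongr
    refine ciSup_le fun φ => ?_
    rw [Real.sqrt_le_left hM0]
    simpa only [sq_abs] using hM φ.1 φ.2
  · intro h k u v
    have h0 : 0 ≤ ⨆ φ : {φ : ContinuousMultilinearMap ℝ X ℝ // ‖φ‖ ≤ 1},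
        Real.sqrt (∑ i, |φ.1 (u i) - φ.1 (v i)| ^ 2) :=
      Real.iSup_nonneg fun φ => Real.sqrt_nonneg _
    rw [Real.sqrt_le_left (by positivity)]
    refine h k u v _ h0 fun φ hφ => ?_
    have := le_ciSup (bdd2 u v) ⟨φ, hφ⟩
    rw [Real.sqrt_le_left h0] at this
    simpa only [sq_abs] using this

/-- scaling of the first coordinate -/
def scal (hn : 1 ≤ n) (w : ℝ) (m : ∀ l, X l) : ∀ l, X l :=
  Function.update m ⟨0, hn⟩ (w • m ⟨0, hn⟩)

lemma map_scal (hn : 1 ≤ n) (w : ℝ) (m : ∀ l, X l) (T : ContinuousMultilinearMap ℝ X Y) :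
    T (scal hn w m) = w • T m := by
  rw [scal, ContinuousMultilinearMap.map_update_smul, Function.update_eq_self]

lemma one_to_two (hn : 1 ≤ n) (T : ContinuousMultilinearMap ℝ X Y) {c : ℝ} (hc : 0 ≤ c)
    (h : LipschitzPSumming 1 c T) : LipschitzPSumming 2 c T := by
  rw [lip1_iff hc] at h
  rw [lip2_iff hc]
  intro k u v M hM0 hM
  set t : Fin k → ℝ := fun i => ‖T (u i) - T (v i)‖ with ht
  set A := ∑ i, t i ^ 2 with hA
  have hA0 : 0 ≤ A := Finset.sum_nonneg fun i _ => sq_nonneg _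
  have := h k (fun i => scal hn (t i) (u i)) (fun i => scal hn (t i) (v i)) (Real.sqrt A * M)
    (fun φ hφ => by
      simp only [map_scal, smul_eq_mul, ← mul_sub, abs_mul]
      refine (Real.sum_mul_le_sqrt_mul_sqrt Finset.univ _ _).trans ?_
      simp only [sq_abs]
      gcongr
      rw [Real.sqrt_le_left hM0]
      exact hM φ hφ)
  simp only [map_scal, ← smul_sub, norm_smul] at this
  have e : ∑ i, ‖t i‖ * ‖T (u i) - T (v i)‖ = A := by
    refine Finset.sum_congr rfl fun i _ => ?_
    rw [Real.norm_of_nonneg (norm_nonneg _), ← sq]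
  rw [e] at this
  have hs := Real.sq_sqrt hA0
  have hs0 := Real.sqrt_nonneg A
  rcases hs0.eq_or_lt with h0 | h0
  · have hA' : A = 0 := by rw [← hs, ← h0]; norm_num
    rw [hA']; positivity
  · have h1 : Real.sqrt A ≤ c * M := by
      refine le_of_mul_le_mul_left ?_ h0
      rw [← sq, hs]; linarith
    rw [← hs]
    gcongr

lemma two_to_one (hn : 1 ≤ n) (hX : ∀ i, IsL1Space (X i)) (T : ContinuousMultilinearMap ℝ X Y)
    {c : ℝ} (hc : 0 ≤ c) (h : LipschitzPSumming 2 c T) :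
    ∃ c', 0 ≤ c' ∧ LipschitzPSumming 1 c' T := by
  choose lam hlam0 hlam using fun l => l1_local (hX l)
  have hΛ : 0 ≤ ∏ l, lam l := Finset.prod_nonneg fun l _ => hlam0 l
  have hc' : 0 ≤ 9 * c * ∏ l, lam l := by positivity
  refine ⟨9 * c * ∏ l, lam l, hc', ?_⟩
  rw [lip2_iff hc] at h
  rw [lip1_iff hc']
  intro k u v M hM
  have := nonempty_ball (X := X)
  have main : ∀ ε : ℝ, 0 < ε →
      ∑ i, ‖T (u i) - T (v i)‖ ≤ (9 * c * ∏ l, lam l) * M + k * ε := by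
    intro ε hε
    obtain ⟨z, hz, hzt⟩ := separation
      (fun (φ : {φ : ContinuousMultilinearMap ℝ X ℝ // ‖φ‖ ≤ 1}) (i : Fin k) =>
        c ^ 2 * (φ.1 (u i) - φ.1 (v i)) ^ 2)
      (fun i => ‖T (u i) - T (v i)‖ ^ 2) (by
        intro w hw M' hM'
        have hM0 : 0 ≤ M' := by
          have := hM' ⟨0, by simp⟩
          simpa using this
        rcases hc.eq_or_lt with hc0 | hc0
        · have := h k (fun i => scal hn (Real.sqrt (w i)) (u i))
            (fun i => scal hn (Real.sqrt (w i)) (v i))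
            (∑ i, Real.sqrt (w i) * (∏ l, ‖u i l‖ + ∏ l, ‖v i l‖)) (by positivity)
            (fun φ hφ => by
              simp only [map_scal, smul_eq_mul, ← mul_sub]
              refine le_trans (le_of_eq ?_) ((Finset.sum_sq_le_sq_sum_of_nonneg (s := Finset.univ)
                (f := fun i => |Real.sqrt (w i) * (φ (u i) - φ (v i))|)
                (fun i _ => abs_nonneg _)).trans ?_)
              · simp only [sq_abs]
              · refine pow_le_pow_left₀ (Finset.sum_nonneg fun i _ => abs_nonneg _) ?_ 2
                refine Finset.sum_le_sum fun i _ => ?_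
                rw [abs_mul, abs_of_nonneg (Real.sqrt_nonneg _)]
                gcongr
                exact abs_le_of_ball φ hφ _ _)
          rw [← hc0, zero_mul] at this
          simp only [map_scal, ← smul_sub, norm_smul, mul_pow, Real.norm_eq_abs, sq_abs] at this
          simp only [Real.sq_sqrt (hw _)] at this
          linarith
        · have := h k (fun i => scal hn (Real.sqrt (w i)) (u i))
            (fun i => scal hn (Real.sqrt (w i)) (v i)) (Real.sqrt M' / c) (by positivity)
            (fun φ hφ => by
              simp only [map_scal, smul_eq_mul, ← mul_sub, mul_pow, Real.sq_sqrt (hw _)]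
              rw [div_pow, Real.sq_sqrt hM0, le_div_iff₀ (by positivity), Finset.sum_mul]
              refine le_trans (le_of_eq ?_) (hM' ⟨φ, hφ⟩)
              exact Finset.sum_congr rfl fun i _ => by ring)
          rw [mul_div_cancel₀ _ hc0.ne', Real.sq_sqrt hM0] at this
          simp only [map_scal, ← smul_sub, norm_smul, mul_pow, Real.norm_eq_abs, sq_abs] at this
          simpa only [Real.sq_sqrt (hw _)] using this)
      (ε := ε ^ 2) (by positivity)
    obtain ⟨N, ν, φ, hν, hν1, hzφ⟩ : ∃ (N : ℕ) (ν : Fin N → ℝ)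
        (φ : Fin N → {φ : ContinuousMultilinearMap ℝ X ℝ // ‖φ‖ ≤ 1}),
        (∀ j, 0 ≤ ν j) ∧ ∑ j, ν j = 1 ∧
        ∀ i, z i = ∑ j, ν j * (c ^ 2 * ((φ j).1 (u i) - (φ j).1 (v i)) ^ 2) := by
      rw [mem_convexHull_iff_exists_fintype] at hz
      obtain ⟨ι, _, w, y, hw, hw1, hy, hz⟩ := hz
      choose φ hφ using hy
      let E := (Fintype.equivFin ι).symm
      refine ⟨Fintype.card ι, w ∘ E, φ ∘ E, fun j => hw _, ?_, fun i => ?_⟩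
      · rw [← hw1]; exact E.sum_comp w
      · rw [← hz, Finset.sum_apply, ← E.sum_comp]
        refine Finset.sum_congr rfl fun j _ => ?_
        rw [← hφ]; rfl
    obtain ⟨ψ, hψ, hψL⟩ := compactness hΛ u v
      (local_form lam hlam u v (fun j => (φ j).1) (fun j => (φ j).2) ν hν hν1)
    have hψM : ∑ i, |ψ (u i) - ψ (v i)| ≤ (∏ l, lam l) * M := by
      rcases hΛ.eq_or_lt with h0 | h0
      · rw [← h0] at hψ ⊢
        have : ψ = 0 := by simpa using hψ
        simp [this]
      · have := hM ((∏ l, lam l)⁻¹ • ψ) (by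
          rw [norm_smul, norm_inv, Real.norm_of_nonneg hΛ]
          rw [inv_mul_le_one₀ h0]; exact hψ)
        simp only [smul_apply, smul_eq_mul, ← mul_sub, abs_mul, abs_inv,
          abs_of_pos h0, ← Finset.mul_sum] at this
        rwa [inv_mul_le_iff₀ h0] at this
    have ht : ∀ i, ‖T (u i) - T (v i)‖ ≤
        c * Real.sqrt (∑ j, ν j * ((φ j).1 (u i) - (φ j).1 (v i)) ^ 2) + ε := by
      intro i
      have h1 := hzt i
      have h2 : z i = c ^ 2 * ∑ j, ν j * ((φ j).1 (u i) - (φ j).1 (v i)) ^ 2 := by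
        rw [hzφ, Finset.mul_sum]
        exact Finset.sum_congr rfl fun j _ => by ring
      have h3 : 0 ≤ ∑ j, ν j * ((φ j).1 (u i) - (φ j).1 (v i)) ^ 2 :=
        Finset.sum_nonneg fun j _ => mul_nonneg (hν j) (sq_nonneg _)
      rw [h2] at h1
      have h4 := Real.sq_sqrt h3
      have h5 := Real.sqrt_nonneg (∑ j, ν j * ((φ j).1 (u i) - (φ j).1 (v i)) ^ 2)
      refine abs_le_of_sq_le_sq' ?_ (by positivity) |>.2
      rw [← h4] at h1
      nlinarith [mul_nonneg (mul_nonneg hc h5) hε.le]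
    calc ∑ i, ‖T (u i) - T (v i)‖
        ≤ ∑ i, (c * Real.sqrt (∑ j, ν j * ((φ j).1 (u i) - (φ j).1 (v i)) ^ 2) + ε) :=
          Finset.sum_le_sum fun i _ => ht i
      _ = c * ∑ i, Real.sqrt (∑ j, ν j * ((φ j).1 (u i) - (φ j).1 (v i)) ^ 2) + k * ε := by
          rw [Finset.sum_add_distrib, ← Finset.mul_sum]; simp
      _ ≤ c * (9 * ((∏ l, lam l) * M)) + k * ε := by
          gcongr
          linarith
      _ = _ := by ring
  refine le_of_forall_pos_le_add fun ε hε => ?_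
  refine (main (ε / (k + 1)) (by positivity)).trans ?_
  have : (k:ℝ) * (ε / (k + 1)) ≤ ε := by
    rw [mul_div_assoc', div_le_iff₀ (by positivity)]
    nlinarith
  linarith

end

end LipSum

/-- If `X₁, …, Xₙ` are `𝓛₁`-spaces, then a continuous `n`-linear operator
`T : X₁ × ⋯ × Xₙ → Y` is Lipschitz `1`-summing iff it is Lipschitz `2`-summing. -/
theorem lipschitz1Summing_iff_lipschitz2Summing {n : ℕ} (hn : 1 ≤ n) {X : Fin n → Type*}
    [∀ i, NormedAddCommGroup (X i)] [∀ i, NormedSpace ℝ (X i)] [∀ i, CompleteSpace (X i)]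
    {Y : Type*} [NormedAddCommGroup Y] [NormedSpace ℝ Y] [CompleteSpace Y]
    (hX : ∀ i, IsL1Space (X i)) (T : ContinuousMultilinearMap ℝ X Y) :
    (∃ c : ℝ, 0 ≤ c ∧ LipschitzPSumming 1 c T) ↔
      (∃ c : ℝ, 0 ≤ c ∧ LipschitzPSumming 2 c T) := by
  constructor
  · rintro ⟨c, hc, h⟩
    exact ⟨c, hc, LipSum.one_to_two hn T hc h⟩
  · rintro ⟨c, hc, h⟩
    exact LipSum.two_to_one hn hX T hc h
end

section
/- Let 1 ≤ p < ∞, let X and Y be real Banach spaces, let n ≥ 1, and let P : X → Y be a continuous n-homogeneous polynomial (i.e., P(x) = T(x, …, x) for some continuous n-linear operator T : X × ⋯ × X → Y). For c ≥ 0, the following are equivalent: (1) for every finite family u₁, …, u_k, v₁, …, v_k ∈ X, (Σᵢ ‖P(uᵢ) − P(vᵢ)‖^p)^{1/p} ≤ c · sup{ (Σᵢ |q(uᵢ) − q(vᵢ)|^p)^{1/p} : q a continuous n-homogeneous scalar polynomial on X with sup_{‖x‖≤1} |q(x)| ≤ 1 }; (2) there exists a Borel probability measure μ on the closed unit ball B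 of continuous n-homogeneous scalar polynomials on X, equipped with the topology of pointwise convergence, such that for all u, v ∈ X, ‖P(u) − P(v)‖ ≤ c · ( ∫_B |q(u) − q(v)|^p dμ(q) )^{1/p}. -/
open scoped BigOperators
open MeasureTheory

/-- The closed unit ball of continuous `n`-homogeneous scalar polynomials on `X`
(maps of the form `x ↦ φ(x, …, x)` for a continuous `n`-linear form `φ`, of supremum
norm at most one on the unit ball). -/
def PolyBall (n : ℕ) (X : Type*) [NormedAddCommGroup X] [NormedSpace ℝ X] : Type _ :=
  {q : X → ℝ //
    (∃ φ : ContinuousMultilinearMap ℝ (fun _ : Fin n => X) ℝ, ∀ x, q x = φ fun _ => x) ∧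
    ∀ x : X, ‖x‖ ≤ 1 → |q x| ≤ 1}

/-- The topology of pointwise convergence on the unit ball of continuous
`n`-homogeneous scalar polynomials. -/
instance PolyBall.topologicalSpace (n : ℕ) (X : Type*) [NormedAddCommGroup X]
    [NormedSpace ℝ X] : TopologicalSpace (PolyBall n X) :=
  TopologicalSpace.induced (fun (q : PolyBall n X) => q.1) Pi.topologicalSpace

/-- The Borel σ-algebra of the topology of pointwise convergence. -/
instance PolyBall.measurableSpace (n : ℕ) (X : Type*) [NormedAddCommGroup X]
    [NormedSpace ℝ X] : MeasurableSpace (PolyBall n X) :=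
  borel (PolyBall n X)


namespace PolyAux

/-- Signs. -/
noncomputable def sg (b : Bool) : ℝ := if b then 1 else -1

lemma sg_mul_self (b : Bool) : sg b * sg b = 1 := by cases b <;> simp [sg]

lemma abs_sg (b : Bool) : |sg b| = 1 := by cases b <;> simp [sg]

lemma sum_sg : ∑ b : Bool, sg b = 0 := by simp [sg]

variable {X : Type*} [NormedAddCommGroup X] [NormedSpace ℝ X]

/-- The polarization of a function. -/
noncomputable def pol (n : ℕ) (q : X → ℝ) (m : Fin n → X) : ℝ :=
  (∑ ε : Fin n → Bool, (∏ i, sg (ε i)) * q (∑ i, sg (ε i) • m i)) / (2 ^ n * n.factorial)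

lemma weight_bij {n : ℕ} (r : Fin n → Fin n) (hr : Function.Bijective r) :
    ∑ ε : Fin n → Bool, (∏ i, sg (ε i)) * ∏ j, sg (ε (r j)) = 2 ^ n := by
  have : ∀ ε : Fin n → Bool, (∏ i, sg (ε i)) * ∏ j, sg (ε (r j)) = 1 := by
    intro ε
    rw [hr.prod_comp (fun i => sg (ε i)), ← Finset.prod_mul_distrib]
    simp [sg_mul_self]
  simp [this]

lemma weight_not {n : ℕ} (r : Fin n → Fin n) (hr : ¬ Function.Bijective r) :
    ∑ ε : Fin n → Bool, (∏ i, sg (ε i)) * ∏ j, sg (ε (r j)) = 0 := by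
  classical
  have hs : ¬ Function.Surjective r := fun h => hr (Finite.surjective_iff_bijective.1 h)
  simp only [Function.Surjective, not_forall, not_exists] at hs
  obtain ⟨i0, hi0⟩ := hs
  have h1 : ∀ ε : Fin n → Bool, (∏ i, sg (ε i)) * ∏ j, sg (ε (r j)) =
      ∏ i, (sg (ε i) * ∏ j with r j = i, sg (ε i)) := by
    intro ε
    rw [Finset.prod_mul_distrib]
    congr 1
    rw [← Finset.prod_fiberwise (s := Finset.univ) (g := r)]
    refine Finset.prod_congr rfl fun i _ => Finset.prod_congr rfl fun j hj => ?_
    rw [(Finset.mem_filter.1 hj).2]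
  simp_rw [h1]
  have h2 := Finset.prod_univ_sum (fun _ : Fin n => (Finset.univ : Finset Bool))
    (fun i b => sg b * ∏ j with r j = i, sg b)
  rw [Fintype.piFinset_univ] at h2
  rw [← h2]
  refine Finset.prod_eq_zero (Finset.mem_univ i0) ?_
  rw [Finset.filter_false_of_mem (fun j _ => hi0 j)]
  simp [sg]

lemma pol_eq {n : ℕ} (φ : MultilinearMap ℝ (fun _ : Fin n => X) ℝ) (q : X → ℝ)
    (hq : ∀ x, q x = φ fun _ => x) (m : Fin n → X) :
    pol n q m = (((n.factorial : ℝ)⁻¹) • ∑ σ : Equiv.Perm (Fin n), φ.domDomCongr σ) m := by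
  classical
  have h1 : ∀ ε : Fin n → Bool, q (∑ i, sg (ε i) • m i) =
      ∑ r : Fin n → Fin n, (∏ j, sg (ε (r j))) * φ (fun j => m (r j)) := by
    intro ε
    rw [hq, φ.map_sum (g := fun _ i => sg (ε i) • m i)]
    refine Finset.sum_congr rfl fun r _ => ?_
    rw [φ.map_smul_univ (fun j => sg (ε (r j))) (fun j => m (r j)), smul_eq_mul]
  have h2 : ∑ ε : Fin n → Bool, (∏ i, sg (ε i)) * q (∑ i, sg (ε i) • m i) =
      2 ^ n * ∑ σ : Equiv.Perm (Fin n), φ (fun j => m (σ j)) := by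
    simp_rw [h1, Finset.mul_sum]
    rw [Finset.sum_comm]
    have h3 : ∀ r : Fin n → Fin n,
        ∑ ε : Fin n → Bool, (∏ i, sg (ε i)) * ((∏ j, sg (ε (r j))) * φ (fun j => m (r j))) =
        if Function.Bijective r then 2 ^ n * φ (fun j => m (r j)) else 0 := by
      intro r
      simp_rw [← mul_assoc]
      rw [← Finset.sum_mul]
      split_ifs with h
      · rw [weight_bij r h]
      · rw [weight_not r h, zero_mul]
    simp_rw [h3]
    rw [← Finset.sum_filter]
    symm
    refine Finset.sum_bij (fun (σ : Equiv.Perm (Fin n)) _ => (σ : Fin n → Fin n)) ?_ ?_ ?_ ?_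
    · intro σ _; exact Finset.mem_filter.2 ⟨Finset.mem_univ _, σ.bijective⟩
    · intro a _ b _ h; exact DFunLike.coe_injective h
    · intro b hb
      exact ⟨Equiv.ofBijective b (Finset.mem_filter.1 hb).2, Finset.mem_univ _, rfl⟩
    · intro σ _; rfl
  rw [pol, h2, smul_apply, sum_apply]
  simp only [MultilinearMap.domDomCongr_apply, smul_eq_mul]
  rw [mul_div_mul_left _ _ (by positivity)]
  rw [div_eq_inv_mul]

lemma pol_diag {n : ℕ} (φ : MultilinearMap ℝ (fun _ : Fin n => X) ℝ) (q : X → ℝ)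
    (hq : ∀ x, q x = φ fun _ => x) (x : X) : pol n q (fun _ => x) = q x := by
  rw [pol_eq φ q hq, smul_apply, sum_apply]
  simp only [MultilinearMap.domDomCongr_apply, smul_eq_mul, ← hq]
  rw [Finset.sum_const, Finset.card_univ, Fintype.card_perm, Fintype.card_fin, nsmul_eq_mul,
    inv_mul_cancel_left₀ (by positivity)]

lemma hom_smul {Z : Type*} [AddCommGroup Z] [Module ℝ Z] {n : ℕ}
    (φ : MultilinearMap ℝ (fun _ : Fin n => X) Z) (q : X → Z)
    (hq : ∀ x, q x = φ fun _ => x) (t : ℝ) (x : X) : q (t • x) = t ^ n • q x := by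
  rw [hq, hq, φ.map_smul_univ (fun _ => t) (fun _ => x)]
  simp

lemma bound {n : ℕ} (φ : MultilinearMap ℝ (fun _ : Fin n => X) ℝ) (q : X → ℝ)
    (hq : ∀ x, q x = φ fun _ => x) (hb : ∀ x : X, ‖x‖ ≤ 1 → |q x| ≤ 1) (x : X) :
    |q x| ≤ ‖x‖ ^ n := by
  by_cases hx : x = 0
  · subst hx
    rcases Nat.eq_zero_or_pos n with rfl | hn
    · simpa using hb 0 (by simp)
    · have : q 0 = 0 := by
        have := hom_smul φ q hq 0 0
        rw [zero_pow hn.ne'] at this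
        simpa using this
      simp [this, hn.ne']
  · have hx' : ‖x‖ ≠ 0 := by simpa using hx
    have h := hom_smul φ q hq ‖x‖ (‖x‖⁻¹ • x)
    rw [smul_inv_smul₀ hx'] at h
    rw [h, smul_eq_mul, abs_mul, abs_of_nonneg (by positivity : (0:ℝ) ≤ ‖x‖ ^ n)]
    refine mul_le_of_le_one_right (by positivity) (hb _ ?_)
    rw [norm_smul, norm_inv, norm_norm, inv_mul_cancel₀ hx']

/-- Closed description of the unit ball. -/
def S (n : ℕ) (X : Type*) [NormedAddCommGroup X] [NormedSpace ℝ X] : Set (X → ℝ) :=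
  {q | (∀ (m : Fin n → X) i x y, pol n q (Function.update m i (x + y)) =
      pol n q (Function.update m i x) + pol n q (Function.update m i y)) ∧
    (∀ (m : Fin n → X) i (c : ℝ) x, pol n q (Function.update m i (c • x)) =
      c * pol n q (Function.update m i x)) ∧
    (∀ x, pol n q (fun _ => x) = q x) ∧ ∀ x, |q x| ≤ ‖x‖ ^ n}

lemma continuous_pol (n : ℕ) (m : Fin n → X) : Continuous fun q : X → ℝ => pol n q m := by
  unfold pol
  fun_prop

lemma isCompact_S (n : ℕ) : IsCompact (S n X) := by
  have hK : IsCompact (Set.univ.pi fun x : X => Set.Icc (-(‖x‖ ^ n)) (‖x‖ ^ n)) := by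
    exact isCompact_univ_pi fun x => isCompact_Icc
  refine hK.of_isClosed_subset ?_ fun q hq x _ => abs_le.1 (hq.2.2.2 x)
  have hp := continuous_pol (X := X) n
  have he : ∀ x : X, Continuous fun q : X → ℝ => q x := fun x => continuous_apply x
  simp only [S, Set.ofPred_and, Set.ofPred_forall]
  refine IsClosed.inter ?_ (IsClosed.inter ?_ (IsClosed.inter ?_ ?_))
  · refine isClosed_iInter fun m => isClosed_iInter fun i => isClosed_iInter fun x =>
      isClosed_iInter fun y => isClosed_eq (hp _) ((hp _).add (hp _))
  · refine isClosed_iInter fun m => isClosed_iInter fun i => isClosed_iInter fun x =>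
      isClosed_iInter fun y => isClosed_eq (hp _) (continuous_const.mul (hp _))
  · exact isClosed_iInter fun x => isClosed_eq (hp _) (he x)
  · exact isClosed_iInter fun x => isClosed_le (he x).abs continuous_const

lemma pol_bound (n : ℕ) (q : X → ℝ) (hq : ∀ x, |q x| ≤ ‖x‖ ^ n) (m : Fin n → X)
    (hm : ∀ i, ‖m i‖ ≤ 1) :
    |pol n q m| ≤ (∑ _ε : Fin n → Bool, (n : ℝ) ^ n) / (2 ^ n * n.factorial) := by
  rw [pol, abs_div, abs_of_nonneg (by positivity : (0:ℝ) ≤ 2 ^ n * n.factorial)]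
  gcongr
  refine (Finset.abs_sum_le_sum_abs _ _).trans (Finset.sum_le_sum fun ε _ => ?_)
  rw [abs_mul, Finset.abs_prod]
  simp only [abs_sg, Finset.prod_const_one, one_mul]
  refine (hq _).trans ?_
  gcongr
  refine (norm_sum_le _ _).trans ?_
  calc ∑ i, ‖sg (ε i) • m i‖ ≤ ∑ i : Fin n, (1 : ℝ) := by
        refine Finset.sum_le_sum fun i _ => ?_
        rw [norm_smul, Real.norm_eq_abs, abs_sg, one_mul]
        exact hm i
    _ = n := by simp

lemma mem_S_iff (n : ℕ) (q : X → ℝ) : q ∈ S n X ↔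
    ((∃ φ : ContinuousMultilinearMap ℝ (fun _ : Fin n => X) ℝ, ∀ x, q x = φ fun _ => x) ∧
    ∀ x : X, ‖x‖ ≤ 1 → |q x| ≤ 1) := by
  constructor
  · rintro ⟨h1, h2, h3, h4⟩
    refine ⟨?_, fun x hx => (h4 x).trans (pow_le_one₀ (norm_nonneg _) hx)⟩
    let ψ : MultilinearMap ℝ (fun _ : Fin n => X) ℝ :=
      { toFun := pol n q
        map_update_add' := by
          intro _ m i x y
          convert h1 m i x y
        map_update_smul' := by
          intro _ m i x y
          rw [smul_eq_mul]
          convert h2 m i x y }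
    refine ⟨ψ.mkContinuous ((∑ _ε : Fin n → Bool, (n : ℝ) ^ n) / (2 ^ n * n.factorial)) ?_,
      fun x => (h3 x).symm⟩
    intro m
    by_cases hm : ∃ i, m i = 0
    · obtain ⟨i, hi⟩ := hm
      rw [ψ.map_coord_zero i hi, norm_zero]
      positivity
    · push Not at hm
      have e : m = fun i => ‖m i‖ • (‖m i‖⁻¹ • m i) := by
        funext i
        rw [smul_inv_smul₀ (by simpa using hm i)]
      have e2 : ψ m = (∏ i, ‖m i‖) • ψ (fun i => ‖m i‖⁻¹ • m i) := by
        conv_lhs => rw [e]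
        rw [ψ.map_smul_univ (fun i => ‖m i‖) (fun i => ‖m i‖⁻¹ • m i)]
      rw [e2, norm_smul, Real.norm_of_nonneg (by positivity), mul_comm]
      gcongr
      refine pol_bound n q h4 _ fun i => ?_
      rw [norm_smul, norm_inv, norm_norm, inv_mul_cancel₀ (by simpa using hm i)]
  · rintro ⟨⟨φ, hφ⟩, hb⟩
    refine ⟨?_, ?_, fun x => pol_diag φ.toMultilinearMap q hφ x,
      fun x => bound φ.toMultilinearMap q hφ hb x⟩
    · intro m i x y
      simp only [pol_eq φ.toMultilinearMap q hφ]
      exact MultilinearMap.map_update_add _ m i x y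
    · intro m i c x
      simp only [pol_eq φ.toMultilinearMap q hφ]
      exact MultilinearMap.map_update_smul _ m i c x

instance compactSpace (n : ℕ) : CompactSpace (PolyBall n X) := by
  have h : S n X = {q : X → ℝ |
    (∃ φ : ContinuousMultilinearMap ℝ (fun _ : Fin n => X) ℝ, ∀ x, q x = φ fun _ => x) ∧
    ∀ x : X, ‖x‖ ≤ 1 → |q x| ≤ 1} := Set.ext fun q => mem_S_iff n q
  have h2 := isCompact_S (X := X) n
  rw [h] at h2
  exact isCompact_iff_compactSpace.1 h2

instance t2Space (n : ℕ) : T2Space (PolyBall n X) :=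
  inferInstanceAs (T2Space {q : X → ℝ //
    (∃ φ : ContinuousMultilinearMap ℝ (fun _ : Fin n => X) ℝ, ∀ x, q x = φ fun _ => x) ∧
    ∀ x : X, ‖x‖ ≤ 1 → |q x| ≤ 1})

instance borelSpace (n : ℕ) : BorelSpace (PolyBall n X) := ⟨rfl⟩

instance nonempty (n : ℕ) : Nonempty (PolyBall n X) :=
  ⟨⟨fun _ => 0, ⟨0, fun x => rfl⟩, by simp⟩⟩

lemma continuous_eval (n : ℕ) (x : X) : Continuous fun q : PolyBall n X => q.1 x :=
  (continuous_apply x).comp continuous_induced_dom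

open CompactlySupportedContinuousMap in
lemma exists_prob {K : Type*} [TopologicalSpace K] [CompactSpace K] [T2Space K] [Nonempty K]
    [MeasurableSpace K] [BorelSpace K] (t : Set C(K, ℝ)) (ht : Convex ℝ t) (h0 : 0 ∈ t)
    (hpos : ∀ g ∈ t, ∃ x, 0 ≤ g x) :
    ∃ μ : Measure K, IsProbabilityMeasure μ ∧ ∀ g ∈ t, 0 ≤ ∫ x, g x ∂μ := by
  let s : Set C(K, ℝ) := {g | ∀ x, g x < 0}
  have hs1 : Convex ℝ s := by
    intro f hf g hg a b ha hb hab x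
    have h1 := hf x
    have h2 := hg x
    simp only [ContinuousMap.add_apply, ContinuousMap.smul_apply, smul_eq_mul]
    rcases ha.eq_or_lt with rfl | ha
    · have : b = 1 := by linarith
      subst this
      linarith
    · nlinarith [mul_neg_of_pos_of_neg ha h1, mul_nonneg hb (neg_nonneg.2 h2.le)]
  have hs2 : IsOpen s := by
    have := ContinuousMap.isOpen_setOfPred_mapsTo (X := K) (Y := ℝ) isCompact_univ
      (isOpen_Iio (a := (0:ℝ)))
    convert this using 1
    ext g
    simp [s, Set.MapsTo]
  have hd : Disjoint s t := by
    rw [Set.disjoint_left]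
    intro g hg hgt
    obtain ⟨x, hx⟩ := hpos g hgt
    exact absurd (hg x) (not_lt.2 hx)
  obtain ⟨f, w, hf, hw⟩ := geometric_hahn_banach_open hs1 hs2 ht hd
  have hw0 : w ≤ 0 := by simpa using hw 0 h0
  have hneg : ∀ ε : ℝ, 0 < ε → ∀ g : C(K, ℝ), (∀ x, 0 ≤ g x) → -(f g) - ε * f 1 < w := by
    intro ε hε g hg
    have := hf (-g - ε • 1) (by
      intro x
      have := hg x
      simp
      linarith)
    simpa using this
  have hf1 : 0 < f 1 := by
    have := hneg 1 one_pos 0 (fun x => by simp)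
    simp at this
    linarith
  have hw1 : 0 ≤ w := by
    by_contra h
    push Not at h
    have := hneg (-w / f 1) (div_pos (by linarith) hf1) 0 (fun x => by simp)
    rw [div_mul_cancel₀ _ hf1.ne'] at this
    simp at this
  have hfp : ∀ g : C(K, ℝ), (∀ x, 0 ≤ g x) → 0 ≤ f g := by
    intro g hg
    by_contra h
    push Not at h
    have := hneg (-(f g) / f 1) (div_pos (by linarith) hf1) g hg
    rw [div_mul_cancel₀ _ hf1.ne'] at this
    linarith
  let L : CompactlySupportedContinuousMap K ℝ →ₗ[ℝ] ℝ :=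
    { toFun := fun g => (f 1)⁻¹ * f g.toContinuousMap
      map_add' := by
        intro a b
        rw [← mul_add, ← map_add]; rfl
      map_smul' := by
        intro a b
        have : f (a • b).toContinuousMap = a * f b.toContinuousMap := by
          rw [← smul_eq_mul, ← map_smul]; rfl
        rw [this]
        simp only [RingHom.id_apply, smul_eq_mul]
        ring }
  let Λ := PositiveLinearMap.mk₀ L (fun g hg =>
    mul_nonneg (inv_nonneg.2 hf1.le) (hfp _ (fun x => CompactlySupportedContinuousMap.le_def.1 hg x)))
  have hInt : ∀ g : C(K, ℝ), ∫ x, g x ∂(RealRMK.rieszMeasure Λ) = (f 1)⁻¹ * f g := fun g =>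
    RealRMK.integral_rieszMeasure Λ (continuousMapEquiv g)
  refine ⟨RealRMK.rieszMeasure Λ, ⟨?_⟩, fun g hg => ?_⟩
  · have h1 := hInt 1
    rw [inv_mul_cancel₀ hf1.ne'] at h1
    simp only [ContinuousMap.one_apply, integral_const, smul_eq_mul, mul_one] at h1
    rw [Measure.real, ENNReal.toReal_eq_one_iff] at h1
    exact h1
  · rw [hInt]
    exact mul_nonneg (inv_nonneg.2 hf1.le) (hw1.trans (hw g hg))

lemma continuous_term (n : ℕ) {p : ℝ} (hp : 1 ≤ p) (u v : X) :
    Continuous fun q : PolyBall n X => |q.1 u - q.1 v| ^ p :=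
  (((continuous_eval n u).sub (continuous_eval n v)).abs).rpow_const
    (fun _ => Or.inr (by linarith))

lemma le_of_rpow {A B c p : ℝ} (hp : 1 ≤ p) (hA : 0 ≤ A) (hB : 0 ≤ B) (hc : 0 ≤ c) :
    A ^ (1 / p) ≤ c * B ^ (1 / p) ↔ A ≤ c ^ p * B := by
  have hp0 : 0 < p := by linarith
  have h : c * B ^ (1 / p) = (c ^ p * B) ^ (1 / p) := by
    rw [Real.mul_rpow (by positivity) hB, one_div, Real.rpow_rpow_inv hc hp0.ne']
  rw [h, Real.rpow_le_rpow_iff hA (by positivity) (by positivity)]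

end PolyAux

/-- Pietsch domination for homogeneous polynomials: a continuous `n`-homogeneous
polynomial `P : X → Y` satisfies the Lipschitz `p`-summing inequality with constant `c`
iff there is a Borel probability measure `μ` on the unit ball of scalar `n`-homogeneous
polynomials (with the topology of pointwise convergence) dominating `P`. -/
theorem lipschitzPSummingPolynomial_iff_domination {X Y : Type*}
    [NormedAddCommGroup X] [NormedSpace ℝ X] [CompleteSpace X]
    [NormedAddCommGroup Y] [NormedSpace ℝ Y] [CompleteSpace Y]
    (p : ℝ) (hp : 1 ≤ p) (n : ℕ) (hn : 1 ≤ n) (P : X → Y)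
    (hP : ∃ T : ContinuousMultilinearMap ℝ (fun _ : Fin n => X) Y,
      ∀ x, P x = T fun _ => x)
    (c : ℝ) (hc : 0 ≤ c) :
    (∀ (k : ℕ) (u v : Fin k → X),
        (∑ i, ‖P (u i) - P (v i)‖ ^ p) ^ (1 / p) ≤
          c * ⨆ q : PolyBall n X, (∑ i, |q.1 (u i) - q.1 (v i)| ^ p) ^ (1 / p)) ↔
      ∃ μ : Measure (PolyBall n X), IsProbabilityMeasure μ ∧
        ∀ u v : X,
          ‖P u - P v‖ ≤ c * (∫ q : PolyBall n X, |q.1 u - q.1 v| ^ p ∂μ) ^ (1 / p) := by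
  have hp0 : 0 < p := by linarith
  have hterm := PolyAux.continuous_term (X := X) n hp
  constructor
  · intro H
    obtain ⟨T, hT⟩ := hP
    let F : X → X → C(PolyBall n X, ℝ) := fun u v =>
      ⟨fun q => c ^ p * |q.1 u - q.1 v| ^ p - ‖P u - P v‖ ^ p,
        (continuous_const.mul (hterm u v)).sub continuous_const⟩
    have hF : ∀ u v q, F u v q = c ^ p * |q.1 u - q.1 v| ^ p - ‖P u - P v‖ ^ p :=
      fun _ _ _ => rfl
    let t : Set C(PolyBall n X, ℝ) :=
      {g | ∃ (k : ℕ) (u v : Fin k → X), g = ∑ i, F (u i) (v i)}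
    have hsmul : ∀ a : ℝ, 0 ≤ a → ∃ s : ℝ, ∀ u v, a • F u v = F (s • u) (s • v) := by
      intro a ha
      have hn0 : (n : ℝ) ≠ 0 := by positivity
      refine ⟨a ^ (1 / (n * p)), fun u v => ?_⟩
      have hs : ((a ^ (1 / (n * p))) ^ n) ^ p = a := by
        rw [← Real.rpow_natCast, ← Real.rpow_mul ha, ← Real.rpow_mul ha]
        have : 1 / (n * p) * n * p = 1 := by field_simp
        rw [this, Real.rpow_one]
      have hs0 : 0 ≤ a ^ (1 / (n * p)) := Real.rpow_nonneg ha _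
      generalize a ^ (1 / (n * p)) = s at hs hs0
      ext q
      obtain ⟨φ, hφ⟩ := q.2.1
      rw [ContinuousMap.smul_apply, hF, hF]
      rw [PolyAux.hom_smul φ.toMultilinearMap q.1 hφ, PolyAux.hom_smul φ.toMultilinearMap q.1 hφ,
        PolyAux.hom_smul T.toMultilinearMap P hT, PolyAux.hom_smul T.toMultilinearMap P hT,
        ← smul_sub, ← smul_sub, norm_smul, smul_eq_mul, smul_eq_mul, abs_mul, Real.norm_eq_abs,
        abs_of_nonneg (pow_nonneg hs0 n), Real.mul_rpow (pow_nonneg hs0 n) (abs_nonneg _),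
        Real.mul_rpow (pow_nonneg hs0 n) (norm_nonneg _), hs]
      ring
    have ht : Convex ℝ t := by
      rintro _ ⟨k, u, v, rfl⟩ _ ⟨l, u', v', rfl⟩ a b ha hb -
      obtain ⟨s, hs⟩ := hsmul a ha
      obtain ⟨s', hs'⟩ := hsmul b hb
      refine ⟨k + l, Fin.append (fun i => s • u i) (fun i => s' • u' i),
        Fin.append (fun i => s • v i) (fun i => s' • v' i), ?_⟩
      simp only [Fin.sum_univ_add, Fin.append_left, Fin.append_right, Finset.smul_sum, hs, hs']
    have ht0 : (0 : C(PolyBall n X, ℝ)) ∈ t := ⟨0, Fin.elim0, Fin.elim0, by simp⟩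
    have hpos : ∀ g ∈ t, ∃ q, 0 ≤ g q := by
      rintro _ ⟨k, u, v, rfl⟩
      have hcont : Continuous fun q : PolyBall n X => ∑ i, |q.1 (u i) - q.1 (v i)| ^ p :=
        continuous_finsetSum _ fun i _ => hterm (u i) (v i)
      obtain ⟨q0, -, hq0⟩ := isCompact_univ.exists_isMaxOn Set.univ_nonempty hcont.continuousOn
      refine ⟨q0, ?_⟩
      have h1 := H k u v
      have h2 : (⨆ q : PolyBall n X, (∑ i, |q.1 (u i) - q.1 (v i)| ^ p) ^ (1 / p)) ≤
          (∑ i, |q0.1 (u i) - q0.1 (v i)| ^ p) ^ (1 / p) := by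
        refine ciSup_le fun q => ?_
        refine Real.rpow_le_rpow (by positivity) (hq0 (Set.mem_univ q)) (by positivity)
      have h3 := h1.trans (mul_le_mul_of_nonneg_left h2 hc)
      rw [PolyAux.le_of_rpow hp (by positivity) (by positivity) hc] at h3
      rw [ContinuousMap.sum_apply]
      simp only [hF, Finset.sum_sub_distrib, ← Finset.mul_sum]
      linarith
    obtain ⟨μ, hμ, hInt⟩ := PolyAux.exists_prob t ht ht0 hpos
    refine ⟨μ, hμ, fun u v => ?_⟩
    have h1 := hInt (F u v) ⟨1, fun _ => u, fun _ => v, by simp⟩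
    simp only [hF] at h1
    have hi : Integrable (fun q : PolyBall n X => |q.1 u - q.1 v| ^ p) μ :=
      (hterm u v).integrable_of_hasCompactSupport (HasCompactSupport.of_compactSpace _)
    rw [integral_sub (hi.const_mul _) (integrable_const _), integral_const_mul] at h1
    simp only [integral_const, probReal_univ, one_smul] at h1
    have h2 : (‖P u - P v‖ ^ p) ^ (1 / p) ≤
        c * (∫ q : PolyBall n X, |q.1 u - q.1 v| ^ p ∂μ) ^ (1 / p) := by
      rw [PolyAux.le_of_rpow hp (by positivity)
        (integral_nonneg fun q => by positivity) hc]
      linarith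
    rwa [one_div, Real.rpow_rpow_inv (norm_nonneg _) hp0.ne', ← one_div] at h2
  · rintro ⟨μ, hμ, H⟩ k u v
    have hcont : Continuous fun q : PolyBall n X => ∑ i, |q.1 (u i) - q.1 (v i)| ^ p :=
      continuous_finsetSum _ fun i _ => hterm (u i) (v i)
    have hi : ∀ u v : X, Integrable (fun q : PolyBall n X => |q.1 u - q.1 v| ^ p) μ :=
      fun u v => (hterm u v).integrable_of_hasCompactSupport (HasCompactSupport.of_compactSpace _)
    obtain ⟨q0, -, hq0⟩ := isCompact_univ.exists_isMaxOn Set.univ_nonempty hcont.continuousOn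
    have h2 : (∑ i, |q0.1 (u i) - q0.1 (v i)| ^ p) ^ (1 / p) ≤
        ⨆ q : PolyBall n X, (∑ i, |q.1 (u i) - q.1 (v i)| ^ p) ^ (1 / p) := by
      refine le_ciSup (f := fun q : PolyBall n X =>
        (∑ i, |q.1 (u i) - q.1 (v i)| ^ p) ^ (1 / p))
        ⟨(∑ i, |q0.1 (u i) - q0.1 (v i)| ^ p) ^ (1 / p), ?_⟩ q0
      rintro _ ⟨q, rfl⟩
      exact Real.rpow_le_rpow (by positivity) (hq0 (Set.mem_univ q)) (by positivity)
    refine le_trans ?_ (mul_le_mul_of_nonneg_left h2 hc)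
    rw [PolyAux.le_of_rpow hp (by positivity) (by positivity) hc]
    calc ∑ i, ‖P (u i) - P (v i)‖ ^ p
        ≤ ∑ i, c ^ p * ∫ q : PolyBall n X, |q.1 (u i) - q.1 (v i)| ^ p ∂μ := by
          refine Finset.sum_le_sum fun i _ => ?_
          rw [← PolyAux.le_of_rpow hp (by positivity)
            (integral_nonneg fun q => by positivity) hc]
          rw [one_div, Real.rpow_rpow_inv (norm_nonneg _) hp0.ne', ← one_div]
          exact H (u i) (v i)
      _ = c ^ p * ∫ q : PolyBall n X, ∑ i, |q.1 (u i) - q.1 (v i)| ^ p ∂μ := by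
          rw [← Finset.mul_sum, integral_finsetSum _ fun i _ => hi (u i) (v i)]
      _ ≤ c ^ p * ∑ i, |q0.1 (u i) - q0.1 (v i)| ^ p := by
          refine mul_le_mul_of_nonneg_left ?_ (by positivity)
          calc ∫ q : PolyBall n X, ∑ i, |q.1 (u i) - q.1 (v i)| ^ p ∂μ
              ≤ ∫ _q : PolyBall n X, ∑ i, |q0.1 (u i) - q0.1 (v i)| ^ p ∂μ :=
                integral_mono (integrable_finsetSum _ fun i _ => hi (u i) (v i))
                  (integrable_const _) (fun q => hq0 (Set.mem_univ q))
            _ = _ := by simp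
end
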